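/- arXiv:1309.2167 — 3 statements merged into one kernel-verified Lean document; each statement's English description precedes it below -/
import Mathlib

section
/- Let k ≥ 1 be odd and let d_k(t) = (1/π)·lim_{y→0⁺} Im g_k(t + iy) for t ∈ I_k ∖ {0}. Then d_k is strictly increasing on (Γ(x_k), 0) with d_k(t) → 0 as t → Γ(x_k)⁺ and d_k(t) → +∞ as t → 0⁻, and d_k is strictly decreasing on (0, Γ(x_{k+1})) with d_k(t) → +∞ as t → 0⁺ and d_k(t) → 0 as t → Γ(x_{k+1})⁻. -/
open Complex Filter

/-- The holomorphic branch `L` of `log Γ` on `ℂ ∖ (−∞,0]`: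
`L(z) = −γz − Log z − ∑_{k=1}^∞ (Log(1 + z/k) − z/k)`. -/
noncomputable def logGamma (z : ℂ) : ℂ :=
  -(Real.eulerMascheroniConstant : ℂ) * z - Complex.log z -
    ∑' k : ℕ, (Complex.log (1 + z / (k + 1)) - z / (k + 1))

open scoped Topology ComplexConjugate

namespace LogGamma

/-! ### The principal logarithm on the closed upper half plane -/

lemma continuousWithinAt_log_upper {z : ℂ} (hz : z ≠ 0) :
    ContinuousWithinAt Complex.log {z : ℂ | 0 ≤ z.im} z := by
  by_cases h : z ∈ slitPlane
  · exact (continuousAt_clog h).continuousWithinAt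
  · rw [mem_slitPlane_iff, not_or, not_lt, not_not] at h
    refine continuousWithinAt_log_of_re_neg_of_im_zero (lt_of_le_of_ne h.1 fun h0 => hz ?_) h.2
    exact Complex.ext h0 h.2

lemma im_conj_mul_log_sub_neg {p q : ℂ} (hp0 : p ≠ 0) (hp : 0 ≤ p.im) (hq : 0 < q.im)
    (hpq : p ≠ q) : (conj (q - p) * (Complex.log q - Complex.log p)).im < 0 := by
  set γ : ℝ → ℂ := fun s => p + s * (q - p) with hγ
  have him (s : ℝ) : (γ s).im = (1 - s) * p.im + s * q.im := by simp [hγ]; ring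
  have hpos {s : ℝ} (h0 : 0 < s) (h1 : s ≤ 1) : 0 < (γ s).im := by
    rw [him]; nlinarith [mul_nonneg (sub_nonneg.2 h1) hp, mul_pos h0 hq]
  have hnn {s : ℝ} (hs : s ∈ Set.Icc (0 : ℝ) 1) : 0 ≤ (γ s).im := by
    rw [him]; nlinarith [mul_nonneg (sub_nonneg.2 hs.2) hp, mul_nonneg hs.1 hq.le]
  have hne {s : ℝ} (hs : s ∈ Set.Icc (0 : ℝ) 1) : γ s ≠ 0 := by
    rcases hs.1.eq_or_lt with h | h
    · simpa [hγ, ← h] using hp0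
    · intro h0
      have := hpos h hs.2
      simp [h0] at this
  have hcont : Continuous γ := by fun_prop
  have hanti : StrictAntiOn (fun s : ℝ => (conj (q - p) * Complex.log (γ s)).im)
      (Set.Icc 0 1) := by
    refine strictAntiOn_of_deriv_neg (convex_Icc 0 1) ?_ ?_
    · intro s hs
      have h := (continuousWithinAt_log_upper (hne hs)).comp
        (hcont.continuousWithinAt (s := Set.Icc 0 1) (x := s)) (fun r hr => hnn hr)
      exact Complex.continuous_im.continuousAt.comp_continuousWithinAt (h.const_mul _)
    · intro s hs
      rw [interior_Icc] at hs
      have hs' := hpos hs.1 hs.2.le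
      have h1 : HasDerivAt γ (q - p) s := by
        have := ((Complex.ofRealCLM.hasDerivAt (x := s)).mul_const (q - p)).const_add p
        simpa [hγ] using this
      have h2 := ((h1.clog_real (Or.inr hs'.ne')).const_mul (conj (q - p)))
      have h3 := Complex.imCLM.hasFDerivAt.comp_hasDerivAt s h2
      have h4 : HasDerivAt (fun s : ℝ => (conj (q - p) * Complex.log (γ s)).im)
        ((conj (q - p) * ((q - p) / γ s)).im) s := h3
      rw [h4.deriv]
      have h5 : conj (q - p) * ((q - p) / γ s) = (normSq (q - p) : ℂ) * (γ s)⁻¹ := by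
        rw [normSq_eq_conj_mul_self]; ring
      rw [h5, Complex.im_ofReal_mul, Complex.inv_im]
      have h6 : 0 < normSq (q - p) := normSq_pos.2 (sub_ne_zero.2 hpq.symm)
      have h7 : 0 < normSq (γ s) := normSq_pos.2 (hne ⟨hs.1.le, hs.2.le⟩)
      exact mul_neg_of_pos_of_neg h6 (div_neg_of_neg_of_pos (neg_lt_zero.2 hs') h7)
  have := hanti (Set.left_mem_Icc.2 zero_le_one) (Set.right_mem_Icc.2 zero_le_one) zero_lt_one
  simp only [hγ] at this
  rw [mul_sub, Complex.sub_im, sub_neg]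
  simpa using this

lemma arg_le_im_div_re {z : ℂ} (hre : 0 < z.re) (him : 0 ≤ z.im) : z.arg ≤ z.im / z.re := by
  rw [← tan_arg]
  exact Real.le_tan (arg_nonneg_iff.2 him) (arg_lt_pi_div_two_iff.2 (Or.inl hre))

lemma arg_le_arg_of_re_le {p q : ℂ} (hp : 0 < p.im) (him : p.im = q.im) (hre : p.re ≤ q.re) :
    q.arg ≤ p.arg := by
  rcases hre.eq_or_lt with h | h
  · rw [Complex.ext h him]
  · have hne : p ≠ q := fun e => h.ne (by rw [e])
    have := im_conj_mul_log_sub_neg (p := p) (q := q) (fun e => by simp [e] at hp) hp.le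
      (him ▸ hp) hne
    simp [him, log_im] at this
    nlinarith

lemma pi_div_two_le_arg {z : ℂ} (hre : z.re ≤ 0) (him : 0 < z.im) : Real.pi / 2 ≤ z.arg := by
  by_contra! h
  rw [arg_lt_pi_div_two_iff] at h
  rcases h with h | h | h
  · linarith
  · linarith
  · simp [h] at him

/-! ### The summands of `logGamma` -/

/-- The summand of `logGamma`. -/
noncomputable def term (z : ℂ) (k : ℕ) : ℂ :=
  Complex.log (1 + z / (k + 1)) - z / (k + 1)

lemma logGamma_eq (z : ℂ) :
    logGamma z = -(Real.eulerMascheroniConstant : ℂ) * z - Complex.log z - ∑' k, term z k := rfl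

lemma norm_term_le {z : ℂ} {R : ℝ} (hz : ‖z‖ ≤ R) {k : ℕ} (hk : 2 * R ≤ k) :
    ‖term z k‖ ≤ R ^ 2 * (1 / ((k : ℝ) + 1) ^ 2) := by
  have hk0 : (0 : ℝ) < k + 1 := by positivity
  have hn : ‖z / ((k : ℂ) + 1)‖ = ‖z‖ / (k + 1) := by
    rw [norm_div]; congr 1
    exact_mod_cast Complex.norm_natCast (k + 1)
  have hle : ‖z‖ / ((k : ℝ) + 1) ≤ 1 / 2 := by
    rw [div_le_iff₀ hk0]; linarith
  have h := norm_log_one_add_sub_self_le (z := z / ((k : ℂ) + 1)) (by rw [hn]; linarith)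
  rw [hn] at h
  refine h.trans ?_
  have h2 : (1 - ‖z‖ / ((k : ℝ) + 1))⁻¹ ≤ 2 := by
    rw [inv_le_comm₀ (by linarith) (by norm_num)]; linarith
  calc (‖z‖ / ((k : ℝ) + 1)) ^ 2 * (1 - ‖z‖ / ((k : ℝ) + 1))⁻¹ / 2
      ≤ (‖z‖ / ((k : ℝ) + 1)) ^ 2 * 2 / 2 := by gcongr
    _ ≤ (R / ((k : ℝ) + 1)) ^ 2 * 2 / 2 := by gcongr
    _ = _ := by field_simp

lemma summable_bound (R : ℝ) (N : ℕ) :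
    Summable fun k : ℕ => R ^ 2 * (1 / (((k + N : ℕ) : ℝ) + 1) ^ 2) := by
  have h := (summable_nat_add_iff (N + 1)).2 (Real.summable_one_div_nat_pow.2 one_lt_two)
  refine (h.congr fun k => ?_).mul_left _
  push_cast; ring_nf

lemma summable_term (z : ℂ) : Summable (term z) := by
  obtain ⟨N, hN⟩ := exists_nat_ge (2 * ‖z‖)
  rw [← summable_nat_add_iff N]
  refine Summable.of_norm_bounded (summable_bound ‖z‖ N) fun k => norm_term_le le_rfl ?_
  push_cast
  linarith [(Nat.cast_nonneg k : (0 : ℝ) ≤ k)]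

lemma summable_term_im (z : ℂ) : Summable fun k => (term z k).im :=
  (Complex.hasSum_im (summable_term z).hasSum).summable

lemma summable_term_re (z : ℂ) : Summable fun k => (term z k).re :=
  (Complex.hasSum_re (summable_term z).hasSum).summable

lemma div_succ_im (z : ℂ) (k : ℕ) : (z / ((k : ℂ) + 1)).im = z.im / (k + 1) := by
  have := Complex.div_ofReal_im z ((k : ℝ) + 1)
  push_cast at this; exact this

lemma div_succ_re (z : ℂ) (k : ℕ) : (z / ((k : ℂ) + 1)).re = z.re / (k + 1) := by
  have := Complex.div_ofReal_re z ((k : ℝ) + 1)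
  push_cast at this; exact this

lemma term_im (z : ℂ) (k : ℕ) :
    (term z k).im = (1 + z / ((k : ℂ) + 1)).arg - z.im / (k + 1) := by
  rw [term, Complex.sub_im, log_im, div_succ_im]

lemma logGamma_im (z : ℂ) :
    (logGamma z).im =
      -Real.eulerMascheroniConstant * z.im - z.arg - ∑' k, (term z k).im := by
  rw [logGamma_eq, Complex.sub_im, Complex.sub_im, Complex.im_tsum (summable_term z), log_im]
  simp

lemma one_add_div_ne_zero {z : ℂ} (hz : ∀ n : ℕ, z ≠ -n) (k : ℕ) :
    1 + z / ((k : ℂ) + 1) ≠ 0 := by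
  intro h
  have hk : (k : ℂ) + 1 ≠ 0 := Nat.cast_add_one_ne_zero k
  apply hz (k + 1)
  field_simp at h
  push_cast
  linear_combination h

lemma im_one_add_div (z : ℂ) (k : ℕ) :
    (1 + z / ((k : ℂ) + 1)).im = z.im / (k + 1) := by
  rw [Complex.add_im, div_succ_im]; simp

lemma re_one_add_div (z : ℂ) (k : ℕ) :
    (1 + z / ((k : ℂ) + 1)).re = 1 + z.re / (k + 1) := by
  rw [Complex.add_re, div_succ_re]; simp

lemma continuousWithinAt_term {z : ℂ} (hz : ∀ n : ℕ, z ≠ -n) (k : ℕ) :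
    ContinuousWithinAt (fun z => term z k) {z : ℂ | 0 ≤ z.im} z := by
  have h1 : ContinuousWithinAt (fun z : ℂ => 1 + z / ((k : ℂ) + 1)) {z : ℂ | 0 ≤ z.im} z := by
    fun_prop
  have hmaps : Set.MapsTo (fun z : ℂ => 1 + z / ((k : ℂ) + 1)) {z : ℂ | 0 ≤ z.im}
      {z : ℂ | 0 ≤ z.im} := fun w (hw : 0 ≤ w.im) => by
    change 0 ≤ (1 + w / ((k : ℂ) + 1)).im
    rw [im_one_add_div]; positivity
  have h2 : ContinuousWithinAt (fun z : ℂ => Complex.log (1 + z / ((k : ℂ) + 1)))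
      {z : ℂ | 0 ≤ z.im} z :=
    ContinuousWithinAt.comp (f := fun z : ℂ => 1 + z / ((k : ℂ) + 1))
      (continuousWithinAt_log_upper (one_add_div_ne_zero hz k)) h1 hmaps
  exact h2.sub (by fun_prop)

/-- `logGamma` is continuous on the closed upper half plane away from the poles of `Γ`. -/
lemma continuousWithinAt_logGamma {z : ℂ} (hz : ∀ n : ℕ, z ≠ -n) :
    ContinuousWithinAt logGamma {z : ℂ | 0 ≤ z.im} z := by
  obtain ⟨N, hN⟩ := exists_nat_ge (2 * (‖z‖ + 1))
  have hz0 : z ≠ 0 := by simpa using hz 0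
  have hsplit : logGamma = fun w => -(Real.eulerMascheroniConstant : ℂ) * w - Complex.log w -
      (∑ k ∈ Finset.range N, term w k + ∑' k, term w (k + N)) := by
    funext w
    rw [logGamma_eq, (summable_term w).sum_add_tsum_nat_add]
  rw [hsplit]
  have hk (k : ℕ) : 2 * (‖z‖ + 1) ≤ ((k + N : ℕ) : ℝ) := by
    push_cast; linarith [(Nat.cast_nonneg k : (0 : ℝ) ≤ k)]
  have htail : ContinuousAt (fun w => ∑' k, term w (k + N)) z := by
    refine ContinuousOn.continuousAt (s := Metric.ball 0 (‖z‖ + 1)) ?_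
      (Metric.isOpen_ball.mem_nhds (by simp))
    refine continuousOn_tsum (fun k => ?_) (summable_bound (‖z‖ + 1) N) fun k w hw =>
      norm_term_le (by simpa using (mem_ball_zero_iff.1 hw).le) (hk k)
    intro w hw
    have hw' := mem_ball_zero_iff.1 hw
    refine ContinuousAt.continuousWithinAt ?_
    unfold term
    refine ContinuousAt.sub (ContinuousAt.clog (by fun_prop) (Or.inl ?_)) (by fun_prop)
    rw [re_one_add_div]
    have h1 : -(‖z‖ + 1) ≤ w.re := by linarith [neg_abs_le w.re, Complex.abs_re_le_norm w]
    have h2 : (0 : ℝ) < ((k + N : ℕ) : ℝ) + 1 := by positivity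
    have h3 : -1 < w.re / (((k + N : ℕ) : ℝ) + 1) := by
      rw [lt_div_iff₀ h2]; linarith [hk k, norm_nonneg z]
    linarith
  refine ContinuousWithinAt.sub (ContinuousWithinAt.sub (by fun_prop)
    (continuousWithinAt_log_upper hz0)) (ContinuousWithinAt.add ?_ htail.continuousWithinAt)
  exact tendsto_finsetSum _ fun k _ => continuousWithinAt_term hz k

lemma ne_neg_natCast_of_im_pos {z : ℂ} (hz : 0 < z.im) (n : ℕ) : z ≠ -n := by
  rintro rfl
  simp at hz

/-- The partial products of Weierstrass and of Euler differ by a factor tending to `1`. -/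
lemma exp_partial_logGamma {z : ℂ} (hz : ∀ n : ℕ, z ≠ -n) {n : ℕ} (hn : n ≠ 0) :
    Complex.exp (-(Real.eulerMascheroniConstant : ℂ) * z - Complex.log z -
      ∑ k ∈ Finset.range n, term z k) =
    Complex.exp (((((harmonic n : ℚ) : ℝ) - Real.log n - Real.eulerMascheroniConstant : ℝ) : ℂ)
      * z) * Complex.GammaSeq z n := by
  have hz0 : z ≠ 0 := by simpa using hz 0
  have hn' : (n : ℂ) ≠ 0 := Nat.cast_ne_zero.2 hn
  have hsum : ∑ k ∈ Finset.range n, term z k =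
      ∑ k ∈ Finset.range n, Complex.log (1 + z / (k + 1)) - (((harmonic n : ℚ) : ℝ) : ℂ) * z := by
    simp only [term, Finset.sum_sub_distrib, harmonic]
    congr 1
    push_cast
    rw [Finset.sum_mul]
    exact Finset.sum_congr rfl fun k _ => by rw [div_eq_inv_mul]
  have hprod : Complex.exp (∑ k ∈ Finset.range n, Complex.log (1 + z / (k + 1))) =
      (∏ k ∈ Finset.range n, (z + (k + 1))) / (n.factorial : ℂ) := by
    rw [Complex.exp_sum, ← Finset.prod_range_add_one_eq_factorial]
    push_cast
    rw [← Finset.prod_div_distrib]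
    refine Finset.prod_congr rfl fun k _ => ?_
    rw [Complex.exp_log (one_add_div_ne_zero hz k)]
    have hk : (k : ℂ) + 1 ≠ 0 := Nat.cast_add_one_ne_zero k
    field_simp
    ring
  have hne : ∏ k ∈ Finset.range n, (z + ((k : ℂ) + 1)) ≠ 0 := by
    refine Finset.prod_ne_zero_iff.2 fun k _ h => hz (k + 1) ?_
    push_cast
    linear_combination h
  have hlog : Complex.log (n : ℂ) = ((Real.log n : ℝ) : ℂ) := Complex.natCast_log.symm
  have hfac : (n.factorial : ℂ) ≠ 0 := Nat.cast_ne_zero.2 n.factorial_ne_zero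
  rw [Complex.GammaSeq, Finset.prod_range_succ', Complex.cpow_def_of_ne_zero hn', hlog, hsum]
  have e : -(Real.eulerMascheroniConstant : ℂ) * z - Complex.log z -
      (∑ k ∈ Finset.range n, Complex.log (1 + z / (k + 1)) - (((harmonic n : ℚ) : ℝ) : ℂ) * z) =
      (((((harmonic n : ℚ) : ℝ) - Real.log n - Real.eulerMascheroniConstant : ℝ) : ℂ) * z +
        ((Real.log n : ℝ) : ℂ) * z) - Complex.log z -
        ∑ k ∈ Finset.range n, Complex.log (1 + z / (k + 1)) := by
    push_cast; ring
  rw [e, Complex.exp_sub, Complex.exp_sub, Complex.exp_add, Complex.exp_log hz0, hprod]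
  push_cast
  field_simp
  simp [hz0]

lemma exp_logGamma {z : ℂ} (hz : ∀ n : ℕ, z ≠ -n) :
    Complex.exp (logGamma z) = Complex.Gamma z := by
  have h1 : Tendsto (fun n : ℕ => Complex.exp (-(Real.eulerMascheroniConstant : ℂ) * z -
      Complex.log z - ∑ k ∈ Finset.range n, term z k)) atTop (𝓝 (Complex.exp (logGamma z))) :=
    (Complex.continuous_exp.tendsto _).comp
      (tendsto_const_nhds.sub (summable_term z).hasSum.tendsto_sum_nat)
  have h2 : Tendsto (fun n : ℕ => Complex.exp (((((harmonic n : ℚ) : ℝ) - Real.log n -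
      Real.eulerMascheroniConstant : ℝ) : ℂ) * z) * Complex.GammaSeq z n) atTop
      (𝓝 (Complex.exp (((0 : ℝ) : ℂ) * z) * Complex.Gamma z)) := by
    refine Tendsto.mul ((Complex.continuous_exp.tendsto _).comp (Tendsto.mul_const _
      ((Complex.continuous_ofReal.tendsto _).comp ?_))) (Complex.GammaSeq_tendsto_Gamma z)
    simpa using Real.tendsto_harmonic_sub_log.sub_const Real.eulerMascheroniConstant
  simp only [ofReal_zero, zero_mul, Complex.exp_zero, one_mul] at h2
  refine tendsto_nhds_unique h1 (h2.congr' ?_)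
  filter_upwards [eventually_ne_atTop 0] with n hn
  exact (exp_partial_logGamma hz hn).symm

lemma im_conj_mul_term_sub_nonpos {p q : ℂ} (hp0 : ∀ n : ℕ, p ≠ -n) (hp : 0 ≤ p.im)
    (hq : 0 < q.im) (hpq : p ≠ q) (k : ℕ) :
    (conj (q - p) * (term q k - term p k)).im ≤ 0 := by
  have hk : (0 : ℝ) < (k : ℝ) + 1 := by positivity
  have hkc : (k : ℂ) + 1 ≠ 0 := Nat.cast_add_one_ne_zero k
  have h := im_conj_mul_log_sub_neg (p := 1 + p / ((k : ℂ) + 1)) (q := 1 + q / ((k : ℂ) + 1))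
    (one_add_div_ne_zero hp0 k) (by rw [im_one_add_div]; positivity)
    (by rw [im_one_add_div]; positivity) (fun h => hpq (by field_simp at h; simpa using h))
  have e1 : conj (1 + q / ((k : ℂ) + 1) - (1 + p / ((k : ℂ) + 1))) =
      ((((k : ℝ) + 1)⁻¹ : ℝ) : ℂ) * conj (q - p) := by
    simp; ring
  have e2 : conj (q - p) * (term q k - term p k) =
      conj (q - p) * (Complex.log (1 + q / ((k : ℂ) + 1)) - Complex.log (1 + p / ((k : ℂ) + 1)))
      - ((normSq (q - p) * ((k : ℝ) + 1)⁻¹ : ℝ) : ℂ) := by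
    push_cast
    rw [normSq_eq_conj_mul_self, term, term]
    ring
  rw [e1, mul_assoc, Complex.im_ofReal_mul] at h
  rw [e2, Complex.sub_im, ofReal_im, sub_zero]
  exact (neg_of_mul_neg_right h (inv_pos.2 hk).le).le

/-- Monotonicity of `logGamma` on the upper half plane, closed up at one endpoint; it expresses
that the derivative of `logGamma` has positive imaginary part. -/
lemma im_conj_mul_logGamma_sub_pos {p q : ℂ} (hp0 : ∀ n : ℕ, p ≠ -n) (hp : 0 ≤ p.im)
    (hq : 0 < q.im) (hpq : p ≠ q) :
    0 < (conj (q - p) * (logGamma q - logGamma p)).im := by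
  have hlog := im_conj_mul_log_sub_neg (by simpa using hp0 0) hp hq hpq
  have hs : Summable fun k => conj (q - p) * (term q k - term p k) :=
    ((summable_term q).sub (summable_term p)).mul_left _
  have hsum : (conj (q - p) * (∑' k, term q k - ∑' k, term p k)).im ≤ 0 := by
    rw [← (summable_term q).tsum_sub (summable_term p), ← tsum_mul_left, Complex.im_tsum hs]
    exact tsum_nonpos fun k => im_conj_mul_term_sub_nonpos hp0 hp hq hpq k
  have e : conj (q - p) * (logGamma q - logGamma p) =
      -((Real.eulerMascheroniConstant * normSq (q - p) : ℝ) : ℂ)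
      - conj (q - p) * (Complex.log q - Complex.log p)
      - conj (q - p) * (∑' k, term q k - ∑' k, term p k) := by
    push_cast
    rw [normSq_eq_conj_mul_self, logGamma_eq, logGamma_eq]
    ring
  rw [e, Complex.sub_im, Complex.sub_im, Complex.neg_im, ofReal_im]
  linarith

/-! ### Localisation of the level strips of `Im logGamma` -/

lemma logGamma_im_nonneg {z : ℂ} (hre : 10 ≤ z.re) (him : 0 ≤ z.im) : 0 ≤ (logGamma z).im := by
  have hk (k : ℕ) : (0 : ℝ) < (k : ℝ) + 1 := by positivity
  have harg (k : ℕ) : (1 + z / ((k : ℂ) + 1)).arg ≤ z.im / (k + 1 + z.re) := by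
    refine (arg_le_im_div_re (by rw [re_one_add_div]; have := hk k; positivity)
      (by rw [im_one_add_div]; positivity)).trans_eq ?_
    rw [re_one_add_div, im_one_add_div]
    have := hk k
    field_simp
  have hterm (k : ℕ) : (term z k).im ≤ 0 := by
    rw [term_im, sub_nonpos]
    refine (harg k).trans ?_
    exact div_le_div_of_nonneg_left him (hk k) (by linarith)
  have h0 : (term z 0).im ≤ z.im / 11 - z.im := by
    rw [term_im]
    have h := harg 0
    have h' : z.im / (((0 : ℕ) : ℝ) + 1 + z.re) ≤ z.im / 11 := by
      gcongr; push_cast; linarith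
    simp only [Nat.cast_zero, zero_add, div_one] at h h' ⊢
    linarith
  have hts : ∑' k, (term z k).im ≤ z.im / 11 - z.im := by
    rw [(summable_term_im z).tsum_eq_zero_add]
    have h : ∑' k, (term z (k + 1)).im ≤ 0 := tsum_nonpos fun k => hterm (k + 1)
    linarith
  have ha : z.arg ≤ z.im / 10 :=
    (arg_le_im_div_re (by linarith) him).trans (by gcongr)
  rw [logGamma_im]
  nlinarith [Real.eulerMascheroniConstant_lt_two_thirds]

/-- On horizontal half strips to the left, `Im logGamma` tends to `-∞`. -/
lemma exists_le_re_of_le_logGamma_im (Y C : ℝ) :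
    ∃ B : ℝ, ∀ z : ℂ, 0 < z.im → z.im ≤ Y → C ≤ (logGamma z).im → B ≤ z.re := by
  set σ : ℝ → ℂ := fun y => 1 + y * I with hσ
  have hσre (y : ℝ) : (σ y).re = 1 := by simp [hσ]
  have hσim (y : ℝ) : (σ y).im = y := by simp [hσ]
  obtain ⟨C₀, hC₀⟩ : ∃ C₀, ∀ y ∈ Set.Icc 0 Y, (logGamma (σ y)).im ≤ C₀ := by
    have hc : ContinuousOn (fun y => (logGamma (σ y)).im) (Set.Icc 0 Y) := by
      intro y hy
      have hpole (n : ℕ) : σ y ≠ -n := fun h => by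
        have := congrArg Complex.re h
        rw [hσre] at this
        simp only [neg_re, natCast_re] at this
        linarith [(Nat.cast_nonneg n : (0 : ℝ) ≤ n)]
      refine Complex.continuous_im.continuousAt.comp_continuousWithinAt
        ((continuousWithinAt_logGamma hpole).comp (by fun_prop) fun r hr => ?_)
      change 0 ≤ (σ r).im
      rw [hσim]; exact hr.1
    obtain ⟨C₀, h⟩ := isCompact_Icc.bddAbove_image hc
    exact ⟨C₀, fun y hy => h ⟨y, hy, rfl⟩⟩
  obtain ⟨M, hM⟩ := exists_nat_ge (2 * Y)
  obtain ⟨N, hN⟩ := exists_nat_gt (C₀ - C)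
  refine ⟨-(M + N + 1 : ℕ), fun z hz hzY hC => ?_⟩
  by_contra! hlt
  push_cast at hlt
  have hre1 : z.re ≤ 1 := by
    linarith [(Nat.cast_nonneg N : (0 : ℝ) ≤ N), (Nat.cast_nonneg M : (0 : ℝ) ≤ M)]
  set p := σ z.im with hp
  have hterm (k : ℕ) : (term p k).im ≤ (term z k).im := by
    rw [term_im, term_im, hp, hσim]
    gcongr
    refine arg_le_arg_of_re_le (by rw [im_one_add_div]; positivity)
      (by rw [im_one_add_div, im_one_add_div, hσim]) ?_
    rw [re_one_add_div, re_one_add_div, hσre]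
    gcongr
  have hbig (k : ℕ) (hk : k ∈ Finset.Ico M (M + N)) : 1 ≤ (term z k).im - (term p k).im := by
    rw [Finset.mem_Ico] at hk
    have hk1 : (M : ℝ) ≤ k := by exact_mod_cast hk.1
    have hk2 : (k : ℝ) ≤ M + N := by exact_mod_cast hk.2.le
    have hk0 : (0 : ℝ) < (k : ℝ) + 1 := by positivity
    rw [term_im, term_im, hp, hσim]
    have h1 : Real.pi / 2 ≤ (1 + z / ((k : ℂ) + 1)).arg := by
      refine pi_div_two_le_arg ?_ (by rw [im_one_add_div]; positivity)
      rw [re_one_add_div]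
      have : z.re / ((k : ℝ) + 1) ≤ -1 := by rw [div_le_iff₀ hk0]; linarith
      linarith
    have h2 : (1 + σ z.im / ((k : ℂ) + 1)).arg ≤ 1 / 2 := by
      refine (arg_le_im_div_re (by rw [re_one_add_div, hσre]; positivity)
        (by rw [im_one_add_div, hσim]; positivity)).trans ?_
      rw [re_one_add_div, im_one_add_div, hσre, hσim]
      have : z.im / ((k : ℝ) + 1) / (1 + 1 / ((k : ℝ) + 1)) = z.im / (k + 2) := by
        field_simp; ring
      rw [this, div_le_iff₀ (by positivity)]
      linarith
    linarith [Real.pi_gt_three]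
  have hs := (summable_term_im z).sub (summable_term_im p)
  have hsum : (N : ℝ) ≤ ∑' k, ((term z k).im - (term p k).im) := by
    refine le_trans ?_ (hs.sum_le_tsum (Finset.Ico M (M + N))
      fun k _ => sub_nonneg.2 (hterm k))
    simpa using Finset.card_nsmul_le_sum _ _ 1 hbig
  rw [(summable_term_im z).tsum_sub (summable_term_im p)] at hsum
  have harg : p.arg ≤ z.arg :=
    arg_le_arg_of_re_le hz (by rw [hp, hσim]) (by rw [hp, hσre]; exact hre1)
  have hpC := hC₀ z.im ⟨hz.le, hzY⟩
  rw [logGamma_im] at hC hpC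
  rw [hσim] at hpC
  linarith

/-! ### Boundary values on the real axis -/

lemma arg_ofReal (x : ℝ) : (x : ℂ).arg = if x < 0 then Real.pi else 0 := by
  split_ifs with h
  · exact arg_ofReal_of_neg h
  · exact arg_ofReal_of_nonneg (not_lt.1 h)

lemma one_add_ofReal_div (x : ℝ) (k : ℕ) :
    1 + (x : ℂ) / ((k : ℂ) + 1) = ((1 + x / ((k : ℝ) + 1) : ℝ) : ℂ) := by
  push_cast
  rfl

lemma logGamma_ofReal_im (x : ℝ) : (logGamma x).im = -(⌈-x⌉₊ * Real.pi) := by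
  set f : ℕ → ℝ := fun k => if x + k < 0 then Real.pi else 0 with hf
  have hterm (k : ℕ) : (term x k).im = f (k + 1) := by
    have hk : (0 : ℝ) < (k : ℝ) + 1 := by positivity
    rw [term_im, one_add_ofReal_div, arg_ofReal, hf]
    have hiff : 1 + x / ((k : ℝ) + 1) < 0 ↔ x + ((k + 1 : ℕ) : ℝ) < 0 := by
      have : 1 + x / ((k : ℝ) + 1) = (x + ((k + 1 : ℕ) : ℝ)) / ((k : ℝ) + 1) := by
        push_cast; field_simp; ring
      rw [this, div_neg_iff]
      constructor
      · rintro (⟨-, h⟩ | ⟨h, -⟩)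
        · linarith
        · exact h
      · exact fun h => Or.inr ⟨h, hk⟩
    simp [hiff]
  have hmem (k : ℕ) : x + k < 0 ↔ k < ⌈-x⌉₊ := by
    rw [Nat.lt_ceil]; constructor <;> intro h <;> linarith
  have hsum : HasSum f (⌈-x⌉₊ * Real.pi) := by
    have h : HasSum f (∑ k ∈ Finset.range ⌈-x⌉₊, f k) :=
      hasSum_sum_of_ne_finset_zero fun k hk => by
        rw [Finset.mem_range, ← hmem] at hk
        exact if_neg hk
    have e : ∑ k ∈ Finset.range ⌈-x⌉₊, f k = ⌈-x⌉₊ * Real.pi := by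
      rw [Finset.sum_congr rfl fun k hk => if_pos ((hmem k).2 (Finset.mem_range.1 hk))]
      simp
    rwa [e] at h
  have h0 : (x : ℂ).arg = f 0 := by rw [arg_ofReal]; simp [hf]
  rw [logGamma_im, tsum_congr hterm, h0, ← hsum.tsum_eq, hsum.summable.tsum_eq_zero_add]
  simp
  ring

lemma ofReal_ne_neg_natCast {m : ℕ} {x : ℝ} (hx : x ∈ Set.Ioo (-(m : ℝ)) (-(m : ℝ) + 1))
    (n : ℕ) : x ≠ -n := by
  rintro rfl
  have h1 : (n : ℝ) < m := by linarith [hx.1]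
  have h2 : (m : ℝ) < n + 1 := by linarith [hx.2]
  have h1' : n < m := by exact_mod_cast h1
  have h2' : m < n + 1 := by exact_mod_cast h2
  omega

lemma logGamma_im_of_mem_Ioo {m : ℕ} {x : ℝ} (hx : x ∈ Set.Ioo (-(m : ℝ)) (-(m : ℝ) + 1))
    (hm : 1 ≤ m) : (logGamma x).im = -(m * Real.pi) := by
  have : ⌈-x⌉₊ = m := by
    rw [Nat.ceil_eq_iff (by omega)]
    push_cast [Nat.cast_sub hm]
    exact ⟨by linarith [hx.2], by linarith [hx.1]⟩
  rw [logGamma_ofReal_im, this]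

lemma mem_Ioo_of_logGamma_im {m : ℕ} (hm : 1 ≤ m) {x : ℝ} (hx : ∀ n : ℕ, x ≠ -n)
    (h : (logGamma x).im = -(m * Real.pi)) : x ∈ Set.Ioo (-(m : ℝ)) (-(m : ℝ) + 1) := by
  rw [logGamma_ofReal_im, neg_inj, mul_left_inj' Real.pi_ne_zero, Nat.cast_inj,
    Nat.ceil_eq_iff (by omega)] at h
  push_cast [Nat.cast_sub hm] at h
  exact ⟨lt_of_le_of_ne (by linarith) (hx m).symm, by linarith⟩

lemma Gamma_ofReal_eq {m : ℕ} (hm : 1 ≤ m) {x : ℝ}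
    (hx : x ∈ Set.Ioo (-(m : ℝ)) (-(m : ℝ) + 1)) :
    Real.Gamma x = (-1) ^ m * Real.exp (logGamma x).re := by
  have h := exp_logGamma (z := x) fun n e => ofReal_ne_neg_natCast hx n (by exact_mod_cast e)
  have h' := congrArg Complex.re h
  rw [Complex.exp_re, logGamma_im_of_mem_Ioo hx hm, Real.cos_neg, Real.cos_nat_mul_pi,
    Complex.Gamma_ofReal, ofReal_re] at h'
  rw [← h', mul_comm]

lemma term_ofReal_re (x : ℝ) (k : ℕ) :
    (term x k).re = Real.log (1 + x / (k + 1)) - x / (k + 1) := by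
  rw [term, Complex.sub_re, log_re, div_succ_re, one_add_ofReal_div, norm_real,
    Real.norm_eq_abs, Real.log_abs, ofReal_re]

lemma logGamma_ofReal_re (x : ℝ) :
    (logGamma x).re = -Real.eulerMascheroniConstant * x - Real.log x -
      ∑' k : ℕ, (Real.log (1 + x / (k + 1)) - x / (k + 1)) := by
  rw [logGamma_eq, Complex.sub_re, Complex.sub_re, Complex.re_tsum (summable_term _), log_re]
  congr 1
  · simp
  · exact tsum_congr (term_ofReal_re x)

lemma log_concave_of_mul_pos {a b u v : ℝ} (ha : 0 ≤ a) (hb : 0 ≤ b) (hab : a + b = 1)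
    (h : 0 < u * v) : a * Real.log u + b * Real.log v ≤ Real.log (a * u + b * v) := by
  rcases mul_pos_iff.1 h with ⟨hu, hv⟩ | ⟨hu, hv⟩
  · exact strictConcaveOn_log_Ioi.concaveOn.2 hu hv ha hb hab
  · exact strictConcaveOn_log_Iio.concaveOn.2 hu hv ha hb hab

lemma add_natCast_mul_pos {m : ℕ} {x y : ℝ} (hx : x ∈ Set.Ioo (-(m : ℝ)) (-(m : ℝ) + 1))
    (hy : y ∈ Set.Ioo (-(m : ℝ)) (-(m : ℝ) + 1)) (k : ℕ) : 0 < (x + k) * (y + k) := by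
  rcases lt_or_ge k m with h | h
  · have : (k : ℝ) + 1 ≤ m := by exact_mod_cast h
    exact mul_pos_of_neg_of_neg (by linarith [hx.2]) (by linarith [hy.2])
  · have : (m : ℝ) ≤ k := by exact_mod_cast h
    exact mul_pos (by linarith [hx.1]) (by linarith [hy.1])

/-- `log |Γ|` is convex between consecutive poles. -/
lemma convexOn_logGamma_re (m : ℕ) :
    ConvexOn ℝ (Set.Ioo (-(m : ℝ)) (-(m : ℝ) + 1)) fun x : ℝ => (logGamma x).re := by
  refine ⟨convex_Ioo _ _, fun x hx y hy a b ha hb hab => ?_⟩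
  have hsummable (x : ℝ) :
      Summable fun k : ℕ => Real.log (1 + x / ((k : ℝ) + 1)) - x / ((k : ℝ) + 1) :=
    (summable_term_re x).congr (term_ofReal_re x)
  have hlog := log_concave_of_mul_pos ha hb hab (by simpa using add_natCast_mul_pos hx hy 0)
  have hsum : a * ∑' k : ℕ, (Real.log (1 + x / (k + 1)) - x / (k + 1)) +
      b * ∑' k : ℕ, (Real.log (1 + y / (k + 1)) - y / (k + 1)) ≤
      ∑' k : ℕ, (Real.log (1 + (a * x + b * y) / (k + 1)) - (a * x + b * y) / (k + 1)) := by
    rw [← tsum_mul_left, ← tsum_mul_left,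
      ← ((hsummable x).mul_left a).tsum_add ((hsummable y).mul_left b)]
    refine (((hsummable x).mul_left a).add ((hsummable y).mul_left b)).tsum_le_tsum
      (fun k => ?_) (hsummable _)
    have hk : (0 : ℝ) < (k : ℝ) + 1 := by positivity
    have h := log_concave_of_mul_pos (u := 1 + x / ((k : ℝ) + 1)) (v := 1 + y / ((k : ℝ) + 1))
      ha hb hab (by
        have := add_natCast_mul_pos hx hy (k + 1)
        have e : (1 + x / ((k : ℝ) + 1)) * (1 + y / ((k : ℝ) + 1)) =
            ((x + (k + 1 : ℕ)) * (y + (k + 1 : ℕ))) / ((k : ℝ) + 1) ^ 2 := by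
          push_cast; field_simp; ring
        rw [e]; positivity)
    have e : a * (1 + x / ((k : ℝ) + 1)) + b * (1 + y / ((k : ℝ) + 1)) =
        1 + (a * x + b * y) / ((k : ℝ) + 1) := by
      have : a * (1 + x / ((k : ℝ) + 1)) + b * (1 + y / ((k : ℝ) + 1)) =
        (a + b) + (a * x + b * y) / ((k : ℝ) + 1) := by ring
      rw [this, hab]
    rw [e] at h
    have e2 : (a * x + b * y) / ((k : ℝ) + 1) =
      a * (x / ((k : ℝ) + 1)) + b * (y / ((k : ℝ) + 1)) := by ring
    linarith
  simp only [smul_eq_mul]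
  rw [logGamma_ofReal_re, logGamma_ofReal_re, logGamma_ofReal_re]
  linarith

/-- A critical point of `Γ` minimises `|Γ|` between the adjacent poles. -/
lemma logGamma_re_le_of_deriv_eq_zero {m : ℕ} (hm : 1 ≤ m) {x₀ x : ℝ}
    (hx₀ : x₀ ∈ Set.Ioo (-(m : ℝ)) (-(m : ℝ) + 1)) (hd : deriv Real.Gamma x₀ = 0)
    (hx : x ∈ Set.Ioo (-(m : ℝ)) (-(m : ℝ) + 1)) :
    (logGamma x₀).re ≤ (logGamma x).re := by
  have heq : (fun x : ℝ => (logGamma x).re) =ᶠ[𝓝 x₀] fun x => Real.log (Real.Gamma x) := by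
    filter_upwards [isOpen_Ioo.mem_nhds hx₀] with y hy
    rw [Gamma_ofReal_eq hm hy, ← Real.log_abs, abs_mul, abs_pow, abs_neg, abs_one, one_pow,
      one_mul, Real.log_abs, Real.log_exp]
  have hΓ := (Real.differentiableAt_Gamma (ofReal_ne_neg_natCast hx₀)).hasDerivAt
  have hderiv := (hΓ.log (Real.Gamma_ne_zero (ofReal_ne_neg_natCast hx₀))).congr_of_eventuallyEq
    heq
  rw [hd, zero_div] at hderiv
  exact (convexOn_logGamma_re m).isMinOn_of_rightDeriv_eq_zero (by rwa [interior_Ioo])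
    (hderiv.hasDerivWithinAt.derivWithin (uniqueDiffWithinAt_Ioi x₀)) hx

/-! ### The level lines `Im logGamma = -mπ` -/

/-- `v` is the height of a point of the closed upper half plane, not a pole of `Γ`, at which
`logGamma` takes the value `u - i m π`. -/
def IsLevel (m : ℕ) (u v : ℝ) : Prop :=
  ∃ w : ℂ, w.im = v ∧ 0 ≤ w.im ∧ (∀ n : ℕ, w ≠ -n) ∧ logGamma w = u - m * Real.pi * I

lemma exists_isCompact_of_logGamma_im (Y C : ℝ) :
    ∃ K : Set ℂ, IsCompact K ∧ (∀ w ∈ K, 0 ≤ w.im) ∧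
      ∀ w : ℂ, 0 < w.im → w.im ≤ Y → C ≤ (logGamma w).im → (logGamma w).im < 0 → w ∈ K := by
  obtain ⟨B, hB⟩ := exists_le_re_of_le_logGamma_im Y C
  refine ⟨Set.Icc B 10 ×ℂ Set.Icc 0 Y, isCompact_Icc.reProdIm isCompact_Icc,
    fun w hw => hw.2.1, fun w h0 hY hC hneg => ⟨⟨hB w h0 hY hC, ?_⟩, h0.le, hY⟩⟩
  by_contra! h
  exact hneg.not_ge (logGamma_im_nonneg h.le h0.le)

/-- Bounded families in the upper half plane along which `logGamma` converges to a value of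
negative imaginary part converge along ultrafilters, away from the poles. -/
lemma exists_tendsto_of_tendsto_logGamma {α : Type*} (U : Ultrafilter α) {w : α → ℂ} {Y : ℝ}
    (hw : ∀ᶠ a in U, 0 < (w a).im ∧ (w a).im ≤ Y) {c : ℂ} (hc : c.im < 0)
    (hL : Tendsto (fun a => logGamma (w a)) U (𝓝 c)) :
    ∃ w₀ : ℂ, Tendsto w U (𝓝 w₀) ∧ 0 ≤ w₀.im ∧ (∀ n : ℕ, w₀ ≠ -n) ∧ logGamma w₀ = c := by
  obtain ⟨K, hK, hKim, hmem⟩ := exists_isCompact_of_logGamma_im Y (c.im - 1)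
  have hLim : Tendsto (fun a => (logGamma (w a)).im) U (𝓝 c.im) :=
    (Complex.continuous_im.tendsto c).comp hL
  have hev : ∀ᶠ a in U, w a ∈ K := by
    filter_upwards [hw, hLim.eventually_lt_const hc,
      hLim.eventually_const_lt (sub_one_lt c.im)] with a ha h1 h2
    exact hmem _ ha.1 ha.2 h2.le h1
  obtain ⟨w₀, hw₀K, hw₀⟩ := isCompact_iff_ultrafilter_le_nhds'.1 hK (U.map w) hev
  have hlim : Tendsto w U (𝓝 w₀) := hw₀
  have hpole : ∀ n : ℕ, w₀ ≠ -n := by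
    rintro n rfl
    have h1 : Tendsto (fun a => (Complex.Gamma (w a))⁻¹) U (𝓝 (Complex.Gamma (-n))⁻¹) :=
      (differentiable_one_div_Gamma.continuous.tendsto _).comp hlim
    have h2 : Tendsto (fun a => (Complex.exp (logGamma (w a)))⁻¹) U (𝓝 (Complex.exp c)⁻¹) :=
      ((Complex.continuous_exp.tendsto _).comp hL).inv₀ (Complex.exp_ne_zero c)
    have h3 : Tendsto (fun a => (Complex.Gamma (w a))⁻¹) U (𝓝 (Complex.exp c)⁻¹) := by
      refine h2.congr' ?_
      filter_upwards [hw] with a ha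
      rw [exp_logGamma (ne_neg_natCast_of_im_pos ha.1)]
    have := tendsto_nhds_unique h1 h3
    rw [Complex.Gamma_neg_nat_eq_zero, inv_zero] at this
    exact inv_ne_zero (Complex.exp_ne_zero c) this.symm
  refine ⟨w₀, hlim, hKim _ hw₀K, hpole, tendsto_nhds_unique ?_ hL⟩
  refine (continuousWithinAt_logGamma hpole).tendsto.comp
    (tendsto_nhdsWithin_iff.2 ⟨hlim, ?_⟩)
  filter_upwards [hw] with a ha
  exact ha.1.le

section

variable {m : ℕ} {x₀ : ℝ}

lemma level_im (m : ℕ) (u : ℝ) : ((u : ℂ) - m * Real.pi * I).im = -(m * Real.pi) := by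
  simp

lemma IsLevel.pos (hm : 1 ≤ m) (hx₀ : x₀ ∈ Set.Ioo (-(m : ℝ)) (-(m : ℝ) + 1))
    (hd : deriv Real.Gamma x₀ = 0) {u v : ℝ} (h : IsLevel m u v) (hu : u < (logGamma x₀).re) :
    0 < v := by
  obtain ⟨w, rfl, hw0, hpole, hL⟩ := h
  refine lt_of_le_of_ne hw0 fun h0 => ?_
  have hw : w = (w.re : ℂ) := Complex.ext rfl h0.symm
  rw [hw] at hL
  have hmem : w.re ∈ Set.Ioo (-(m : ℝ)) (-(m : ℝ) + 1) := by
    refine mem_Ioo_of_logGamma_im hm (fun n hn => hpole n ?_) (by rw [hL, level_im])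
    rw [hw, hn]; push_cast; rfl
  have := logGamma_re_le_of_deriv_eq_zero hm hx₀ hd hmem
  rw [hL] at this
  simp at this
  linarith

lemma IsLevel.lt {u₁ u₂ v₁ v₂ : ℝ} (h₁ : IsLevel m u₁ v₁) (h₂ : IsLevel m u₂ v₂)
    (hv : 0 < v₂) (hu : u₁ < u₂) : v₂ < v₁ := by
  obtain ⟨w₁, rfl, hw₁, hpole, hL₁⟩ := h₁
  obtain ⟨w₂, rfl, -, -, hL₂⟩ := h₂
  have hne : w₁ ≠ w₂ := by
    rintro rfl
    rw [hL₁] at hL₂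
    have := congrArg Complex.re hL₂
    simp at this
    exact hu.ne this
  have h := im_conj_mul_logGamma_sub_pos hpole hw₁ hv hne
  have e : (u₂ : ℂ) - m * Real.pi * I - (u₁ - m * Real.pi * I) = ((u₂ - u₁ : ℝ) : ℂ) := by
    push_cast; ring
  rw [hL₁, hL₂, e, mul_comm, Complex.im_ofReal_mul, Complex.conj_im, Complex.sub_im] at h
  nlinarith

lemma tendsto_zero_of_isLevel (hm : 1 ≤ m) (hx₀ : x₀ ∈ Set.Ioo (-(m : ℝ)) (-(m : ℝ) + 1))
    (hd : deriv Real.Gamma x₀ = 0) {α : Type*} {l : Filter α} {u v : α → ℝ}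
    (hu : Tendsto u l (𝓝[<] (logGamma x₀).re)) (hlev : ∀ᶠ a in l, IsLevel m (u a) (v a)) :
    Tendsto v l (𝓝 0) := by
  obtain ⟨hu₁, hu₂⟩ := tendsto_nhdsWithin_iff.1 hu
  rcases l.eq_or_neBot with rfl | hl
  · exact tendsto_bot
  obtain ⟨a₀, ha₀, hlt₀⟩ := (hlev.and hu₂).exists
  have hbd : ∀ᶠ a in l, 0 < v a ∧ v a ≤ v a₀ := by
    filter_upwards [hlev, hu₂, hu₁.eventually_const_lt hlt₀] with a ha hlt hgt
    have hpos := ha.pos hm hx₀ hd hlt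
    exact ⟨hpos, (ha₀.lt ha hpos hgt).le⟩
  rw [tendsto_iff_ultrafilter]
  intro U hU
  have : ∀ a, ∃ w : ℂ, IsLevel m (u a) (v a) → w.im = v a ∧ 0 ≤ w.im ∧ (∀ n : ℕ, w ≠ -n) ∧
      logGamma w = u a - m * Real.pi * I := fun a => by
    by_cases h : IsLevel m (u a) (v a)
    · obtain ⟨w, hw⟩ := h
      exact ⟨w, fun _ => hw⟩
    · exact ⟨0, fun h' => absurd h' h⟩
  choose w hw using this
  have hmpos : (0 : ℝ) < m := by exact_mod_cast hm
  have hx₀L : logGamma x₀ = (logGamma x₀).re - m * Real.pi * I := by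
    refine Complex.ext (by simp) ?_
    rw [level_im, logGamma_im_of_mem_Ioo hx₀ hm]
  have hL : Tendsto (fun a => logGamma (w a)) U (𝓝 (logGamma x₀)) := by
    rw [hx₀L]
    have h : Tendsto (fun a => (u a : ℂ) - m * Real.pi * I) U
        (𝓝 ((logGamma x₀).re - m * Real.pi * I)) :=
      ((Complex.continuous_ofReal.tendsto _).comp (hu₁.mono_left hU)).sub_const _
    refine h.congr' ?_
    filter_upwards [hlev.filter_mono hU] with a ha
    exact (hw a ha).2.2.2.symm
  have hwbd : ∀ᶠ a in (U : Filter α), 0 < (w a).im ∧ (w a).im ≤ v a₀ := by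
    filter_upwards [hlev.filter_mono hU, hbd.filter_mono hU] with a ha hb
    rwa [(hw a ha).1]
  obtain ⟨w₀, hlim, hw₀, -, hLw₀⟩ := exists_tendsto_of_tendsto_logGamma U hwbd
    (by rw [hx₀L, level_im]; exact neg_lt_zero.2 (mul_pos hmpos Real.pi_pos)) hL
  have him : w₀.im = 0 := by
    by_contra hne
    have hpos : 0 < w₀.im := lt_of_le_of_ne hw₀ (Ne.symm hne)
    have h := im_conj_mul_logGamma_sub_pos (p := x₀)
      (fun n e => ofReal_ne_neg_natCast hx₀ n (by exact_mod_cast e)) (by simp) hpos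
      (fun e => hne (by rw [← e, ofReal_im]))
    simp [hLw₀] at h
  have h := (Complex.continuous_im.tendsto w₀).comp hlim
  rw [him] at h
  refine h.congr' ?_
  filter_upwards [hlev.filter_mono hU] with a ha
  exact (hw a ha).1

lemma tendsto_atTop_of_isLevel (hm : 1 ≤ m) (hx₀ : x₀ ∈ Set.Ioo (-(m : ℝ)) (-(m : ℝ) + 1))
    (hd : deriv Real.Gamma x₀ = 0) {α : Type*} {l : Filter α} {u v : α → ℝ}
    (hu : Tendsto u l atBot) (hlev : ∀ᶠ a in l, IsLevel m (u a) (v a)) :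
    Tendsto v l atTop := by
  refine tendsto_atTop.2 fun Y => ?_
  obtain ⟨K, hK, -, hmem⟩ := exists_isCompact_of_logGamma_im Y (-(m * Real.pi))
  obtain ⟨C, hC⟩ := hK.exists_bound_of_continuousOn
    differentiable_one_div_Gamma.continuous.continuousOn
  have hexp : Tendsto (fun a => Real.exp (-u a)) l atTop :=
    Real.tendsto_exp_atTop.comp (tendsto_neg_atBot_atTop.comp hu)
  filter_upwards [hlev, hexp.eventually_gt_atTop C, hu.eventually_lt_atBot (logGamma x₀).re]
    with a ha hCa hua
  have hpos := ha.pos hm hx₀ hd hua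
  obtain ⟨w, hwv, -, hpole, hL⟩ := ha
  by_contra! hlt
  have hmpos : (0 : ℝ) < m := by exact_mod_cast hm
  have him : (logGamma w).im = -(m * Real.pi) := by rw [hL, level_im]
  have hwK := hmem w (hwv ▸ hpos) (hwv ▸ hlt.le) him.ge
    (by rw [him]; exact neg_lt_zero.2 (mul_pos hmpos Real.pi_pos))
  have hb := hC w hwK
  rw [← exp_logGamma hpole, ← Complex.exp_neg, Complex.norm_exp, hL] at hb
  simp at hb
  linarith

end

/-! ### Boundary values of the inverse branches -/

lemma isLevel_of_tendsto_im {k m : ℕ} (hm : 1 ≤ m) {g : ℂ → ℂ}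
    (hgim : ∀ z : ℂ, 0 < z.im → 0 < (g z).im)
    (hgL : ∀ z : ℂ, 0 < z.im →
      logGamma (g z) = Complex.log z - ((k : ℂ) + 1) * Real.pi * I)
    {t v : ℝ} (ht : t ≠ 0)
    (hlog : Complex.log t - ((k : ℂ) + 1) * Real.pi * I = Real.log t - m * Real.pi * I)
    (hv : Tendsto (fun y : ℝ => (g ((t : ℂ) + y * I)).im) (𝓝[>] 0) (𝓝 v)) :
    IsLevel m (Real.log t) v := by
  set U := Ultrafilter.of (𝓝[>] (0 : ℝ))
  have hU : (U : Filter ℝ) ≤ 𝓝[>] 0 := Ultrafilter.of_le _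
  have hpos : ∀ᶠ y : ℝ in 𝓝[>] 0, 0 < ((t : ℂ) + y * I).im := by
    filter_upwards [self_mem_nhdsWithin] with y hy
    simpa using hy
  have hbd : ∀ᶠ y : ℝ in U, 0 < (g ((t : ℂ) + y * I)).im ∧ (g ((t : ℂ) + y * I)).im ≤ v + 1 := by
    filter_upwards [hU hpos, hU (hv.eventually_lt_const (lt_add_one v))] with y h1 h2
    exact ⟨hgim _ h1, h2.le⟩
  have hpath : Tendsto (fun y : ℝ => (t : ℂ) + y * I) (𝓝[>] 0) (𝓝[{z : ℂ | 0 ≤ z.im}] t) := by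
    refine tendsto_nhdsWithin_iff.2 ⟨?_, hpos.mono fun y hy => le_of_lt hy⟩
    have : Continuous fun y : ℝ => (t : ℂ) + y * I := by fun_prop
    simpa using (this.tendsto 0).mono_left nhdsWithin_le_nhds
  have hL : Tendsto (fun y : ℝ => logGamma (g ((t : ℂ) + y * I))) (𝓝[>] 0)
      (𝓝 (Real.log t - m * Real.pi * I)) := by
    rw [← hlog]
    refine (((continuousWithinAt_log_upper (ofReal_ne_zero.2 ht)).tendsto.comp hpath).sub_const
      _).congr' ?_
    filter_upwards [hpos] with y hy
    exact (hgL _ hy).symm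
  have hmpos : (0 : ℝ) < m := by exact_mod_cast hm
  obtain ⟨w, hw, hw0, hpole, hLw⟩ := exists_tendsto_of_tendsto_logGamma U hbd
    (by rw [level_im]; exact neg_lt_zero.2 (mul_pos hmpos Real.pi_pos)) (hL.mono_left hU)
  exact ⟨w, tendsto_nhds_unique ((Complex.continuous_im.tendsto w).comp hw) (hv.mono_left hU),
    hw0, hpole, hLw⟩

end LogGamma

/-- Let `k ≥ 1` be odd and `d_k(t) = (1/π)·lim_{y→0⁺} Im g_k(t+iy)` on
`I_k ∖ {0}`.  Then `d_k` strictly increases on `(Γ(x_k), 0)` from `0` (at `Γ(x_k)⁺`) to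
`+∞` (at `0⁻`), and strictly decreases on `(0, Γ(x_{k+1}))` from `+∞` (at `0⁺`) to `0`
(at `Γ(x_{k+1})⁻`). -/
theorem dk_monotonicity_odd (x : ℕ → ℝ)
    (hxk : ∀ j : ℕ, 1 ≤ j → x j ∈ Set.Ioo (-(j : ℝ)) (-(j : ℝ) + 1) ∧
      deriv Real.Gamma (x j) = 0)
    (k : ℕ) (hk1 : 1 ≤ k) (hkodd : Odd k) (g : ℂ → ℂ)
    (hg : DifferentiableOn ℂ g {z : ℂ | 0 < z.im})
    (hgim : ∀ z : ℂ, 0 < z.im → 0 < (g z).im)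
    (hgL : ∀ z : ℂ, 0 < z.im →
      logGamma (g z) = Complex.log z - ((k : ℂ) + 1) * Real.pi * I)
    (d : ℝ → ℝ)
    (hd : ∀ t ∈ Set.Icc (Real.Gamma (x k)) (Real.Gamma (x (k + 1))) \ {0},
      Tendsto (fun y : ℝ => (1 / Real.pi) * (g ((t : ℂ) + y * I)).im)
        (nhdsWithin 0 (Set.Ioi 0)) (nhds (d t))) :
    StrictMonoOn d (Set.Ioo (Real.Gamma (x k)) 0) ∧
    Tendsto d (nhdsWithin (Real.Gamma (x k)) (Set.Ioi (Real.Gamma (x k)))) (nhds 0) ∧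
    Tendsto d (nhdsWithin 0 (Set.Iio 0)) atTop ∧
    StrictAntiOn d (Set.Ioo 0 (Real.Gamma (x (k + 1)))) ∧
    Tendsto d (nhdsWithin 0 (Set.Ioi 0)) atTop ∧
    Tendsto d (nhdsWithin (Real.Gamma (x (k + 1)))
      (Set.Iio (Real.Gamma (x (k + 1))))) (nhds 0) := by
  have hπ := Real.pi_pos
  obtain ⟨hxa, hda⟩ := hxk k hk1
  obtain ⟨hxb, hdb⟩ := hxk (k + 1) (by omega)
  have hΓa : Real.Gamma (x k) = -Real.exp (logGamma (x k)).re := by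
    rw [LogGamma.Gamma_ofReal_eq hk1 hxa, hkodd.neg_one_pow, neg_one_mul]
  have hΓb : Real.Gamma (x (k + 1)) = Real.exp (logGamma (x (k + 1))).re := by
    rw [LogGamma.Gamma_ofReal_eq (by omega) hxb, hkodd.add_one.neg_one_pow, one_mul]
  have hΓa0 : Real.Gamma (x k) < 0 := by rw [hΓa]; exact neg_lt_zero.2 (Real.exp_pos _)
  have hΓb0 : 0 < Real.Gamma (x (k + 1)) := by rw [hΓb]; exact Real.exp_pos _
  have hlim (t : ℝ) (ht : t ∈ Set.Icc (Real.Gamma (x k)) (Real.Gamma (x (k + 1))) \ {0}) :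
      Tendsto (fun y : ℝ => (g ((t : ℂ) + y * I)).im) (nhdsWithin 0 (Set.Ioi 0))
        (nhds (Real.pi * d t)) := by
    refine ((hd t ht).const_mul Real.pi).congr fun y => ?_
    field_simp
  have hleva (t : ℝ) (ht : t ∈ Set.Ioo (Real.Gamma (x k)) 0) :
      LogGamma.IsLevel k (Real.log t) (Real.pi * d t) := by
    refine LogGamma.isLevel_of_tendsto_im hk1 hgim hgL ht.2.ne ?_
      (hlim t ⟨⟨ht.1.le, (ht.2.trans hΓb0).le⟩, ht.2.ne⟩)
    have : Complex.log t = Real.log t + Real.pi * I := by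
      refine Complex.ext ?_ ?_
      · simp [Complex.log_re]
      · simp [Complex.log_im, arg_ofReal_of_neg ht.2]
    rw [this]
    ring
  have hlevb (t : ℝ) (ht : t ∈ Set.Ioo 0 (Real.Gamma (x (k + 1)))) :
      LogGamma.IsLevel (k + 1) (Real.log t) (Real.pi * d t) := by
    refine LogGamma.isLevel_of_tendsto_im (by omega) hgim hgL ht.1.ne' ?_
      (hlim t ⟨⟨(hΓa0.trans ht.1).le, ht.2.le⟩, ht.1.ne'⟩)
    rw [Complex.ofReal_log ht.1.le]
    push_cast
    rfl
  have hloga (t : ℝ) (ht : t ∈ Set.Ioo (Real.Gamma (x k)) 0) :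
      Real.log t < (logGamma (x k)).re := by
    rw [← Real.log_neg_eq_log, Real.log_lt_iff_lt_exp (neg_pos.2 ht.2)]
    linarith [ht.1]
  have hlogb (t : ℝ) (ht : t ∈ Set.Ioo 0 (Real.Gamma (x (k + 1)))) :
      Real.log t < (logGamma (x (k + 1))).re := by
    rw [Real.log_lt_iff_lt_exp ht.1, ← hΓb]
    exact ht.2
  have hscale (t : ℝ) : Real.pi⁻¹ * (Real.pi * d t) = d t := by field_simp
  refine ⟨fun s hs t ht hst => ?_, ?_, ?_, fun s hs t ht hst => ?_, ?_, ?_⟩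
  · refine lt_of_mul_lt_mul_left ((hleva t ht).lt (hleva s hs)
      ((hleva s hs).pos hk1 hxa hda (hloga s hs)) ?_) hπ.le
    rw [← Real.log_neg_eq_log, ← Real.log_neg_eq_log s]
    exact Real.log_lt_log (neg_pos.2 ht.2) (neg_lt_neg hst)
  · have hev := Ioo_mem_nhdsGT hΓa0
    have hcont : Tendsto Real.log (𝓝[>] (Real.Gamma (x k))) (𝓝 (logGamma (x k)).re) := by
      have h := (Real.continuousAt_log hΓa0.ne).tendsto.mono_left
        (nhdsWithin_le_nhds (s := Set.Ioi (Real.Gamma (x k))))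
      rwa [hΓa, Real.log_neg_eq_log, Real.log_exp, ← hΓa] at h
    have h := LogGamma.tendsto_zero_of_isLevel hk1 hxa hda
      (tendsto_nhdsWithin_iff.2 ⟨hcont, mem_of_superset hev hloga⟩) (mem_of_superset hev hleva)
    simpa [hscale] using h.const_mul Real.pi⁻¹
  · have h := LogGamma.tendsto_atTop_of_isLevel (l := 𝓝[<] 0) hk1 hxa hda
      (Real.tendsto_log_nhdsNE_zero.mono_left
        (nhdsWithin_mono 0 fun t (ht : t < 0) => ht.ne))
      (mem_of_superset (Ioo_mem_nhdsLT hΓa0) hleva)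
    simpa [hscale] using h.const_mul_atTop (inv_pos.2 hπ)
  · exact lt_of_mul_lt_mul_left ((hlevb s hs).lt (hlevb t ht)
      ((hlevb t ht).pos (by omega) hxb hdb (hlogb t ht)) (Real.log_lt_log hs.1 hst)) hπ.le
  · have h := LogGamma.tendsto_atTop_of_isLevel (l := 𝓝[>] 0) (by omega) hxb hdb
      (Real.tendsto_log_nhdsNE_zero.mono_left
        (nhdsWithin_mono 0 fun t (ht : 0 < t) => ht.ne'))
      (mem_of_superset (Ioo_mem_nhdsGT hΓb0) hlevb)
    simpa [hscale] using h.const_mul_atTop (inv_pos.2 hπ)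
  · have hev := Ioo_mem_nhdsLT hΓb0
    have hcont : Tendsto Real.log (𝓝[<] (Real.Gamma (x (k + 1))))
        (𝓝 (logGamma (x (k + 1))).re) := by
      have h := (Real.continuousAt_log hΓb0.ne').tendsto.mono_left
        (nhdsWithin_le_nhds (s := Set.Iio (Real.Gamma (x (k + 1)))))
      rwa [hΓb, Real.log_exp, ← hΓb] at h
    have h := LogGamma.tendsto_zero_of_isLevel (by omega) hxb hdb
      (tendsto_nhdsWithin_iff.2 ⟨hcont, mem_of_superset hev hlogb⟩) (mem_of_superset hev hlevb)
    simpa [hscale] using h.const_mul Real.pi⁻¹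
end

section
/- Let k ≥ 1 be odd and let d_k(t) = (1/π)·lim_{y→0⁺} Im g_k(t + iy) for t ∈ I_k ∖ {0}. Then d_k is Lebesgue integrable on I_k and for every z ∈ ℂ₊ one has g_k(z) = ∫_{Γ(x_k)}^{Γ(x_{k+1})} d_k(t)/(t − z) dt − k. -/
open Complex Filter

theorem summable_log_one_add_div_sub (w : ℂ) :
    Summable fun k : ℕ => Complex.log (1 + w / (k + 1)) - w / (k + 1) := by
  have hs : Summable fun k : ℕ => ‖w‖ ^ 2 * (1 / ((k : ℝ) + 1) ^ 2) := by
    apply Summable.mul_left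
    exact_mod_cast (summable_nat_add_iff 1).2 (Real.summable_one_div_nat_pow.2 one_lt_two)
  refine Summable.of_norm_bounded_eventually_nat hs ?_
  obtain ⟨N, hN⟩ := exists_nat_gt (2 * ‖w‖)
  filter_upwards [eventually_ge_atTop N] with k hk
  have hk' : (N : ℝ) ≤ k := by exact_mod_cast hk
  have hpos : (0 : ℝ) < k + 1 := by positivity
  have hn : ‖w / ((k : ℂ) + 1)‖ = ‖w‖ / (k + 1) := by
    rw [norm_div]
    congr 1
    exact_mod_cast Complex.norm_of_nonneg hpos.le
  have hlt : ‖w / ((k : ℂ) + 1)‖ ≤ 1 / 2 := by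
    rw [hn, div_le_iff₀ hpos]
    linarith
  refine (Complex.norm_log_one_add_sub_self_le (by linarith)).trans ?_
  have hinv : (1 - ‖w / ((k : ℂ) + 1)‖)⁻¹ ≤ 2 := by
    rw [inv_le_comm₀ (by linarith) (by norm_num)]
    linarith
  calc ‖w / ((k : ℂ) + 1)‖ ^ 2 * (1 - ‖w / ((k : ℂ) + 1)‖)⁻¹ / 2
      ≤ ‖w / ((k : ℂ) + 1)‖ ^ 2 * 2 / 2 := by gcongr
    _ = ‖w‖ ^ 2 * (1 / ((k : ℝ) + 1) ^ 2) := by rw [hn]; field_simp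

theorem exp_logGamma {w : ℂ} (hw : ∀ m : ℕ, w ≠ -m) : exp (logGamma w) = Complex.Gamma w := by
  have hw0 : w ≠ 0 := by simpa using hw 0
  have hadd : ∀ j : ℕ, w + (j + 1) ≠ 0 := by
    intro j h
    apply hw (j + 1)
    push_cast
    linear_combination h
  have hj : ∀ j : ℕ, ((j : ℂ) + 1) ≠ 0 := fun j => by exact_mod_cast j.succ_ne_zero
  have hterm : ∀ j : ℕ, 1 + w / ((j : ℂ) + 1) ≠ 0 := by
    intro j h
    apply hadd j
    have := hj j
    field_simp at h
    linear_combination h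
  have hlim : Tendsto (fun n : ℕ => exp (-(Real.eulerMascheroniConstant : ℂ) * w - Complex.log w -
      ∑ k ∈ Finset.range n, (Complex.log (1 + w / (k + 1)) - w / (k + 1)))) atTop
      (nhds (exp (logGamma w))) :=
    (continuous_exp.tendsto _).comp
      ((summable_log_one_add_div_sub w).hasSum.tendsto_sum_nat.const_sub _)
  have hone : Tendsto (fun n : ℕ => exp (w * (((harmonic n : ℝ) - Real.log n -
      Real.eulerMascheroniConstant : ℝ) : ℂ))) atTop (nhds 1) := by
    have h0 : Tendsto (fun n : ℕ => (harmonic n : ℝ) - Real.log n -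
        Real.eulerMascheroniConstant) atTop (nhds 0) := by
      simpa using Real.tendsto_harmonic_sub_log.sub_const Real.eulerMascheroniConstant
    have h1 := (((continuous_ofReal.tendsto _).comp h0).const_mul w)
    simpa [Function.comp_def] using (continuous_exp.tendsto _).comp h1
  have hprod := (Complex.GammaSeq_tendsto_Gamma w).mul hone
  rw [mul_one] at hprod
  refine tendsto_nhds_unique hlim (hprod.congr' ?_)
  filter_upwards [eventually_ne_atTop 0] with n hn
  have hn' : (n : ℂ) ≠ 0 := by exact_mod_cast hn
  have hH : (harmonic n : ℂ) = ∑ k ∈ Finset.range n, 1 / ((k : ℂ) + 1) := by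
    simp [harmonic]
  have hpw : (n : ℂ) ^ w = exp (w * Real.log n) := by
    rw [cpow_def_of_ne_zero hn', mul_comm]
    simp
  have hfac : ((n.factorial : ℕ) : ℂ) = ∏ k ∈ Finset.range n, ((k : ℂ) + 1) := by
    rw [← Finset.prod_range_add_one_eq_factorial]
    push_cast
    rfl
  have hexpsum : exp (∑ k ∈ Finset.range n, Complex.log (1 + w / (k + 1))) =
      ∏ k ∈ Finset.range n, (1 + w / ((k : ℂ) + 1)) := by
    rw [exp_sum]
    exact Finset.prod_congr rfl fun k _ => exp_log (hterm k)
  have hP : ∏ k ∈ Finset.range (n + 1), (w + (k : ℂ)) =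
      w * ((∏ k ∈ Finset.range n, ((k : ℂ) + 1)) *
        ∏ k ∈ Finset.range n, (1 + w / ((k : ℂ) + 1))) := by
    rw [Finset.prod_range_succ', ← Finset.prod_mul_distrib, mul_comm]
    simp only [Nat.cast_zero, add_zero, Nat.cast_add, Nat.cast_one]
    congr 1
    refine Finset.prod_congr rfl fun k _ => ?_
    have := hj k
    field_simp
    ring
  have hsum : ∑ k ∈ Finset.range n, w / ((k : ℂ) + 1) = w * harmonic n := by
    rw [hH, Finset.mul_sum]
    exact Finset.sum_congr rfl fun k _ => by ring
  have h1 : ∏ k ∈ Finset.range n, ((k : ℂ) + 1) ≠ 0 := Finset.prod_ne_zero_iff.2 fun k _ => hj k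
  have h2 : ∏ k ∈ Finset.range n, (1 + w / ((k : ℂ) + 1)) ≠ 0 :=
    Finset.prod_ne_zero_iff.2 fun k _ => hterm k
  have hexp : exp (-(Real.eulerMascheroniConstant : ℂ) * w - Complex.log w -
      ∑ k ∈ Finset.range n, (Complex.log (1 + w / (k + 1)) - w / (k + 1))) =
      exp (w * Real.log n) * exp (w * (((harmonic n : ℝ) - Real.log n -
      Real.eulerMascheroniConstant : ℝ) : ℂ)) / (w * exp (∑ k ∈ Finset.range n,
        Complex.log (1 + w / (k + 1)))) := by
    conv_rhs => rw [← exp_log hw0]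
    rw [exp_log hw0, ← exp_log hw0, ← exp_add, ← exp_add, ← exp_sub, exp_log hw0,
      Finset.sum_sub_distrib, hsum]
    congr 1
    push_cast
    ring
  rw [hexp, GammaSeq, hpw, hfac, hP, hexpsum]
  field_simp

theorem im_log_sub_log_mul_conj_nonpos {a : ℝ} (ha : a ≠ 0) {b : ℂ} (hb : 0 < b.im) :
    ((Complex.log b - Complex.log a) * (starRingEnd ℂ) (b - a)).im ≤ 0 := by
  set c : ℂ := b - a with hc
  have hcim : c.im = b.im := by simp [hc]
  have him : ∀ s : ℝ, ((a : ℂ) + s * c).im = s * b.im := by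
    intro s
    simp [hcim]
  have hder : ∀ s ∈ Set.Ioo (0 : ℝ) 1, HasDerivAt
      (fun s : ℝ => (Complex.log (a + s * c) * (starRingEnd ℂ) c).im)
      ((1 * c / (a + s * c)) * (starRingEnd ℂ) c).im s := by
    intro s hs
    have hslit : (a : ℂ) + s * c ∈ slitPlane := by
      right
      rw [him]
      exact (mul_pos hs.1 hb).ne'
    have h1 : HasDerivAt (fun s : ℝ => (a : ℂ) + s * c) (1 * c) s :=
      ((hasDerivAt_id s).ofReal_comp.mul_const c).const_add _
    exact imCLM.hasFDerivAt.comp_hasDerivAt s ((h1.clog_real hslit).mul_const _)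
  have hanti : AntitoneOn (fun s : ℝ => (Complex.log (a + s * c) * (starRingEnd ℂ) c).im)
      (Set.Icc 0 1) := by
    refine antitoneOn_of_deriv_nonpos (convex_Icc 0 1) ?_ ?_ ?_
    · intro s hs
      have hcont : ContinuousWithinAt (fun s : ℝ => Complex.log (a + s * c)) (Set.Icc 0 1) s := by
        have hlin : ContinuousWithinAt (fun s : ℝ => (a : ℂ) + s * c) (Set.Icc 0 1) s :=
          Continuous.continuousWithinAt (by fun_prop)
        by_cases hslit : (a : ℂ) + s * c ∈ slitPlane
        · exact hlin.clog hslit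
        · rw [mem_slitPlane_iff, not_or, not_not, him] at hslit
          have hs0 : s = 0 := by
            rcases mul_eq_zero.1 hslit.2 with h | h
            · exact h
            · exact absurd h hb.ne'
          subst hs0
          have han : a < 0 := by
            refine lt_of_le_of_ne ?_ ha
            simpa using hslit.1
          have hl : ContinuousWithinAt Complex.log {z : ℂ | 0 ≤ z.im} ((a : ℂ) + (0 : ℝ) * c) :=
            continuousWithinAt_log_of_re_neg_of_im_zero (by simpa using han) (by simp)
          refine ContinuousWithinAt.comp (f := fun s : ℝ => (a : ℂ) + s * c) hl hlin ?_
          intro r hr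
          change 0 ≤ ((a : ℂ) + r * c).im
          rw [him]
          exact mul_nonneg hr.1 hb.le
      exact continuous_im.continuousAt.comp_continuousWithinAt
        (hcont.mul continuousWithinAt_const)
    · rw [interior_Icc]
      exact fun s hs => (hder s hs).differentiableAt.differentiableWithinAt
    · rw [interior_Icc]
      intro s hs
      rw [(hder s hs).deriv]
      have h : (1 * c / (a + s * c)) * (starRingEnd ℂ) c =
          (normSq c : ℂ) * (a + s * c)⁻¹ := by
        rw [normSq_eq_conj_mul_self]
        ring
      rw [h, im_ofReal_mul, inv_im, him]
      apply mul_nonpos_of_nonneg_of_nonpos (normSq_nonneg _)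
      apply div_nonpos_of_nonpos_of_nonneg _ (normSq_nonneg _)
      have := mul_pos hs.1 hb
      linarith
  have h01 := hanti (Set.left_mem_Icc.2 zero_le_one) (Set.right_mem_Icc.2 zero_le_one) zero_le_one
  have hb' : (a : ℂ) + c = b := by rw [hc]; ring
  simp only [ofReal_one, one_mul, ofReal_zero, zero_mul, add_zero, hb'] at h01
  rw [sub_mul, sub_im]
  linarith

theorem im_logGamma_sub_mul_conj_nonneg {p : ℝ} (hp : ∀ m : ℕ, p ≠ -m) {w : ℂ}
    (hw : 0 < w.im) :
    0 ≤ ((logGamma w - logGamma p) * (starRingEnd ℂ) (w - p)).im := by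
  set C : ℂ := (starRingEnd ℂ) (w - p) with hC
  have hreal : (w - p) * C = (normSq (w - p) : ℂ) := by
    rw [hC, normSq_eq_conj_mul_self, mul_comm]
  have hsum := ((summable_log_one_add_div_sub w).sub (summable_log_one_add_div_sub p)).mul_right C
  have hexpand : (logGamma w - logGamma p) * C =
      -(Real.eulerMascheroniConstant : ℂ) * normSq (w - p) -
        (Complex.log w - Complex.log p) * C -
        ∑' k : ℕ, ((Complex.log (1 + w / (k + 1)) - w / (k + 1)) -
          (Complex.log (1 + p / (k + 1)) - p / (k + 1))) * C := by
    rw [tsum_mul_right, (summable_log_one_add_div_sub w).tsum_sub (summable_log_one_add_div_sub p),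
      ← hreal]
    simp only [logGamma]
    ring
  have hfirst := im_log_sub_log_mul_conj_nonpos (a := p) (by simpa using hp 0) hw
  have hterm : ∀ k : ℕ, (((Complex.log (1 + w / (k + 1)) - w / (k + 1)) -
      (Complex.log (1 + p / (k + 1)) - p / (k + 1))) * C).im ≤ 0 := by
    intro k
    have hk : (0 : ℝ) < k + 1 := by positivity
    have hkc : ((k : ℂ) + 1) ≠ 0 := by exact_mod_cast hk.ne'
    have ha : 1 + p / ((k : ℝ) + 1) ≠ 0 := by
      intro h
      apply hp (k + 1)
      field_simp at h
      push_cast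
      linarith
    have hwdiv : w / ((k : ℂ) + 1) = ((((k : ℝ) + 1)⁻¹ : ℝ) : ℂ) * w := by
      push_cast
      field_simp
    have hb : 0 < (1 + w / ((k : ℂ) + 1)).im := by
      rw [hwdiv, add_im, im_ofReal_mul]
      simp only [one_im, zero_add]
      positivity
    have h := im_log_sub_log_mul_conj_nonpos ha hb
    have hcong : (Complex.log (1 + w / (k + 1)) - w / (k + 1)) -
        (Complex.log (1 + p / (k + 1)) - p / (k + 1)) =
        (Complex.log (1 + w / (k + 1)) - Complex.log (1 + p / (k + 1))) -
          ((((k : ℝ) + 1)⁻¹ : ℝ) : ℂ) * (w - p) := by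
      push_cast
      field_simp
      ring
    have hconj : (starRingEnd ℂ) ((1 + w / ((k : ℂ) + 1)) - ((1 + p / ((k : ℝ) + 1) : ℝ) : ℂ)) =
        ((((k : ℝ) + 1)⁻¹ : ℝ) : ℂ) * C := by
      rw [hC, ← conj_ofReal (((k : ℝ) + 1)⁻¹), ← map_mul]
      congr 1
      push_cast
      field_simp
      ring
    rw [hconj, mul_left_comm, im_ofReal_mul] at h
    have h' := nonpos_of_mul_nonpos_right h (inv_pos.2 hk)
    rw [hcong, sub_mul, mul_assoc, hreal, ← ofReal_mul, sub_im, ofReal_im, sub_zero]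
    push_cast at h'
    exact h'
  have htsum : (∑' k : ℕ, ((Complex.log (1 + w / (k + 1)) - w / (k + 1)) -
      (Complex.log (1 + p / (k + 1)) - p / (k + 1))) * C).im ≤ 0 := by
    rw [Complex.im_tsum hsum]
    exact tsum_nonpos hterm
  rw [hexpand, sub_im, sub_im, ← ofReal_neg, ← ofReal_mul, ofReal_im]
  linarith

theorem logGamma_im_ofReal {p : ℝ} {m : ℕ} (hm : 1 ≤ m) (hp : p ∈ Set.Ioo (-(m : ℝ)) (-m + 1)) :
    (logGamma p).im = -(m * Real.pi) := by
  have hm' : (1 : ℝ) ≤ m := by exact_mod_cast hm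
  have hp0 : p < 0 := by linarith [hp.2]
  have hterm : ∀ k : ℕ, (Complex.log (1 + p / (k + 1)) - p / (k + 1)).im =
      if k ∈ Finset.range (m - 1) then Real.pi else 0 := by
    intro k
    have hk : (0 : ℝ) < k + 1 := by positivity
    have hcast : (p : ℂ) / ((k : ℂ) + 1) = ((p / (k + 1) : ℝ) : ℂ) := by push_cast; rfl
    have hcast' : 1 + (p : ℂ) / ((k : ℂ) + 1) = (((p + (k + 1)) / (k + 1) : ℝ) : ℂ) := by
      have : ((k : ℂ) + 1) ≠ 0 := by exact_mod_cast hk.ne'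
      push_cast
      field_simp
      ring
    rw [sub_im, log_im, hcast', hcast, ofReal_im, sub_zero]
    split_ifs with hkm
    · rw [Finset.mem_range] at hkm
      have : ((k + 1 + 1 : ℕ) : ℝ) ≤ m := by exact_mod_cast (by omega : k + 1 + 1 ≤ m)
      push_cast at this
      exact arg_ofReal_of_neg (div_neg_of_neg_of_pos (by linarith [hp.2]) hk)
    · rw [Finset.mem_range] at hkm
      have : (m : ℝ) ≤ ((k + 1 : ℕ) : ℝ) := by exact_mod_cast (by omega : m ≤ k + 1)
      push_cast at this
      exact arg_ofReal_of_nonneg (div_nonneg (by linarith [hp.1]) hk.le)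
  have hsum : (∑' k : ℕ, (Complex.log (1 + p / (k + 1)) - p / (k + 1))).im =
      ((m : ℝ) - 1) * Real.pi := by
    rw [Complex.im_tsum (summable_log_one_add_div_sub p), tsum_congr hterm,
      tsum_eq_sum (s := Finset.range (m - 1)) fun k hk => if_neg hk,
      Finset.sum_congr rfl fun k hk => if_pos hk, Finset.sum_const, Finset.card_range,
      nsmul_eq_mul, Nat.cast_sub hm, Nat.cast_one]
  rw [logGamma, sub_im, sub_im, hsum, ← ofReal_neg, ← ofReal_mul, ofReal_im, log_im,
    arg_ofReal_of_neg hp0]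
  ring

theorem arg_le_im_div_re {w : ℂ} (hre : 0 < w.re) (him : 0 ≤ w.im) : w.arg ≤ w.im / w.re := by
  rw [← tan_arg]
  exact Real.le_tan (arg_nonneg_iff.2 him) (abs_lt.1 (abs_arg_lt_pi_div_two_iff.2 (Or.inl hre))).2

theorem logGamma_im_pos {w : ℂ} (hre : 2 ≤ w.re) (him : 0 < w.im) : 0 < (logGamma w).im := by
  have hterm : ∀ k : ℕ, (Complex.log (1 + w / (k + 1)) - w / (k + 1)).im ≤
      w.im * (1 / ((k : ℝ) + 3) - 1 / ((k : ℝ) + 1)) := by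
    intro k
    have hk : (0 : ℝ) < k + 1 := by positivity
    have hkc : ((k : ℂ) + 1) ≠ 0 := by exact_mod_cast hk.ne'
    have h1 : 1 + w / ((k : ℂ) + 1) = ((((k : ℝ) + 1)⁻¹ : ℝ) : ℂ) * (w + ((k + 1 : ℝ) : ℂ)) := by
      push_cast
      field_simp
      ring
    have h2 : w / ((k : ℂ) + 1) = ((((k : ℝ) + 1)⁻¹ : ℝ) : ℂ) * w := by
      push_cast
      field_simp
    have h3 : (w + ((k + 1 : ℝ) : ℂ)).arg ≤ w.im / (w.re + (k + 1)) := by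
      have := arg_le_im_div_re (w := w + ((k + 1 : ℝ) : ℂ))
        (by rw [add_re, ofReal_re]; linarith) (by rw [add_im, ofReal_im]; linarith)
      simpa only [add_re, add_im, ofReal_re, ofReal_im, add_zero] using this
    rw [sub_im, log_im, h1, h2, arg_real_mul _ (inv_pos.2 hk), im_ofReal_mul]
    have h4 : w.im / (w.re + (k + 1)) ≤ w.im / ((k : ℝ) + 3) := by
      apply div_le_div_of_nonneg_left him.le (by positivity)
      linarith
    have h5 : w.im * (1 / ((k : ℝ) + 3) - 1 / ((k : ℝ) + 1)) =
        w.im / ((k : ℝ) + 3) - ((k : ℝ) + 1)⁻¹ * w.im := by ring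
    linarith
  have hlim := (((continuous_im.tendsto _).comp
    (summable_log_one_add_div_sub w).hasSum.tendsto_sum_nat))
  have hbound : ∀ n : ℕ, (∑ k ∈ Finset.range n, (Complex.log (1 + w / (k + 1)) -
      w / (k + 1))).im ≤ w.im * (1 / ((n : ℝ) + 1) + 1 / ((n : ℝ) + 2) - 3 / 2) := by
    intro n
    induction n with
    | zero => norm_num
    | succ n ih =>
      rw [Finset.sum_range_succ, add_im]
      have := hterm n
      have he : w.im * (1 / (((n + 1 : ℕ) : ℝ) + 1) + 1 / (((n + 1 : ℕ) : ℝ) + 2) - 3 / 2) =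
        w.im * (1 / ((n : ℝ) + 1) + 1 / ((n : ℝ) + 2) - 3 / 2) +
          w.im * (1 / ((n : ℝ) + 3) - 1 / ((n : ℝ) + 1)) := by
        push_cast
        field_simp
        ring
      linarith
  have hlim2 : Tendsto (fun n : ℕ => w.im * (1 / ((n : ℝ) + 1) + 1 / ((n : ℝ) + 2) - 3 / 2)) atTop
      (nhds (w.im * (0 + 0 - 3 / 2))) := by
    refine ((Tendsto.add tendsto_one_div_add_atTop_nhds_zero_nat ?_).sub_const _).const_mul _
    have h := (tendsto_add_atTop_iff_nat (f := fun n : ℕ => 1 / ((n : ℝ) + 1)) 1).2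
      tendsto_one_div_add_atTop_nhds_zero_nat
    refine h.congr fun n => ?_
    push_cast
    ring
  have hsum := le_of_tendsto_of_tendsto' hlim hlim2 hbound
  have harg : w.arg ≤ w.im / 2 :=
    (arg_le_im_div_re (by linarith) him.le).trans
      (div_le_div_of_nonneg_left him.le (by norm_num) hre)
  have hg : Real.eulerMascheroniConstant * w.im < 2 / 3 * w.im :=
    mul_lt_mul_of_pos_right Real.eulerMascheroniConstant_lt_two_thirds him
  rw [logGamma, sub_im, sub_im, ← ofReal_neg, im_ofReal_mul, log_im]
  linarith

theorem norm_Gamma_le_Gamma_re {s : ℂ} (hs : 0 < s.re) :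
    ‖Complex.Gamma s‖ ≤ Real.Gamma s.re := by
  rw [Complex.Gamma_eq_integral hs, Real.Gamma_eq_integral hs, Complex.GammaIntegral]
  refine (MeasureTheory.norm_integral_le_integral_norm _).trans_eq ?_
  refine MeasureTheory.setIntegral_congr_fun measurableSet_Ioi fun x hx => ?_
  have hx' : (0 : ℝ) < x := hx
  simp only [norm_mul, Complex.norm_real, Real.norm_of_nonneg (Real.exp_pos _).le,
    norm_cpow_eq_rpow_re_of_pos hx', sub_re, one_re]

theorem norm_Gamma_le_of_le_im {δ : ℝ} (hδ : 0 < δ) (n : ℕ) :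
    ∀ s : ℂ, δ ≤ s.im → 3 - (n : ℝ) ≤ s.re → s.re ≤ 4 →
      ‖Complex.Gamma s‖ ≤ 6 * (max 1 δ⁻¹) ^ n := by
  have hM : (1 : ℝ) ≤ max 1 δ⁻¹ := le_max_left _ _
  induction n with
  | zero =>
    intro s _ h3 h4
    rw [Nat.cast_zero, sub_zero] at h3
    have h6 : Real.Gamma 4 = 6 := by
      norm_num [Nat.factorial]
    rw [pow_zero, mul_one, ← h6]
    refine (norm_Gamma_le_Gamma_re (by linarith)).trans ?_
    exact Real.Gamma_strictMonoOn_Ici.monotoneOn (Set.mem_Ici.2 (by linarith))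
      (Set.mem_Ici.2 (by norm_num)) h4
  | succ n ih =>
    intro s him h3 h4
    by_cases hs : 3 - (n : ℝ) ≤ s.re
    · refine (ih s him hs h4).trans ?_
      gcongr
      omega
    · have hs0 : s ≠ 0 := by
        rintro rfl
        simp at him
        linarith
      have hnorm : δ ≤ ‖s‖ := him.trans ((le_abs_self _).trans (abs_im_le_norm s))
      have hstep := ih (s + 1) (by simpa using him) (by
        push_cast at h3
        simp only [add_re, one_re]
        linarith) (by
        have : (0 : ℝ) ≤ n := by positivity
        simp only [add_re, one_re]
        linarith)
      rw [Complex.Gamma_add_one s hs0, norm_mul] at hstep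
      calc ‖Complex.Gamma s‖ = ‖s‖⁻¹ * (‖s‖ * ‖Complex.Gamma s‖) := by
            field_simp [norm_ne_zero_iff.2 hs0]
        _ ≤ max 1 δ⁻¹ * (6 * max 1 δ⁻¹ ^ n) := by
            gcongr
            exact (inv_anti₀ hδ hnorm).trans (le_max_right _ _)
        _ = 6 * max 1 δ⁻¹ ^ (n + 1) := by ring

theorem norm_Gamma_le_six {s : ℂ} (him : 1 ≤ s.im) (hre : s.re ≤ 4) : ‖Complex.Gamma s‖ ≤ 6 := by
  obtain ⟨n, hn⟩ := exists_nat_ge (3 - s.re)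
  simpa using norm_Gamma_le_of_le_im one_pos n s him (by linarith) hre

theorem ne_neg_natCast_of_im_pos {w : ℂ} (hw : 0 < w.im) (m : ℕ) : w ≠ -m := by
  rintro rfl
  simp at hw

theorem ne_neg_natCast_of_mem_Ioo {p : ℝ} {m : ℕ} (hp : p ∈ Set.Ioo (-(m : ℝ)) (-m + 1)) (j : ℕ) :
    p ≠ -j := by
  rintro rfl
  have h1 : j < m := by exact_mod_cast neg_lt_neg_iff.1 hp.1
  have h2 : m < j + 1 := by
    have : (m : ℝ) < j + 1 := by linarith [hp.2]
    exact_mod_cast this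
  omega

theorem Gamma_eq_neg_one_pow_mul_exp_re_logGamma {p : ℝ} {m : ℕ} (hm : 1 ≤ m)
    (hp : p ∈ Set.Ioo (-(m : ℝ)) (-m + 1)) :
    Real.Gamma p = (-1) ^ m * Real.exp (logGamma p).re := by
  have h := exp_logGamma (w := p) (by exact_mod_cast ne_neg_natCast_of_mem_Ioo hp)
  rw [Complex.Gamma_ofReal] at h
  have hre := congrArg re h
  rw [exp_re, ofReal_re, logGamma_im_ofReal hm hp, Real.cos_neg, Real.cos_nat_mul_pi] at hre
  rw [← hre, mul_comm]

section LogGammaEquation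

variable {k : ℕ} {z w : ℂ}

theorem logGamma_re_eq_of_eq (hL : logGamma w = Complex.log z - ((k : ℂ) + 1) * Real.pi * I) :
    (logGamma w).re = Real.log ‖z‖ := by
  rw [hL]
  simp [log_re]

theorem logGamma_im_eq_of_eq (hL : logGamma w = Complex.log z - ((k : ℂ) + 1) * Real.pi * I) :
    (logGamma w).im = z.arg - (k + 1) * Real.pi := by
  rw [hL]
  simp [log_im]

theorem norm_Gamma_eq_of_logGamma_eq (hz : 0 < z.im) (hw : 0 < w.im)
    (hL : logGamma w = Complex.log z - ((k : ℂ) + 1) * Real.pi * I) :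
    ‖Complex.Gamma w‖ = ‖z‖ := by
  have hz0 : z ≠ 0 := by
    rintro rfl
    simp at hz
  rw [← exp_logGamma (ne_neg_natCast_of_im_pos hw), norm_exp, logGamma_re_eq_of_eq hL,
    Real.exp_log (norm_pos_iff.2 hz0)]

theorem log_norm_sub_mul_im_le (hw : 0 < w.im)
    (hL : logGamma w = Complex.log z - ((k : ℂ) + 1) * Real.pi * I) {p : ℝ} {m : ℕ} (hm : 1 ≤ m)
    (hp : p ∈ Set.Ioo (-(m : ℝ)) (-m + 1)) :
    (Real.log ‖z‖ - (logGamma p).re) * w.im ≤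
      (z.arg + ((m : ℝ) - k - 1) * Real.pi) * (w.re - p) := by
  have h := im_logGamma_sub_mul_conj_nonneg (ne_neg_natCast_of_mem_Ioo hp) hw
  rw [mul_im, sub_re, sub_im, conj_re, conj_im, sub_re, sub_im, ofReal_re, ofReal_im,
    logGamma_im_ofReal hm hp, logGamma_re_eq_of_eq hL, logGamma_im_eq_of_eq hL] at h
  linarith

theorem re_lt_two_of_logGamma_eq (hw : 0 < w.im)
    (hL : logGamma w = Complex.log z - ((k : ℂ) + 1) * Real.pi * I) : w.re < 2 := by
  by_contra! h
  have h1 := logGamma_im_pos h hw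
  rw [logGamma_im_eq_of_eq hL] at h1
  have h2 : (0 : ℝ) ≤ k * Real.pi := by positivity
  linarith [arg_le_pi z]

end LogGammaEquation

theorem exists_norm_le_of_logGamma_eq (k : ℕ) : ∃ C : ℝ, 0 < C ∧ ∀ z w : ℂ, 0 < z.im → 0 < w.im →
    logGamma w = Complex.log z - ((k : ℂ) + 1) * Real.pi * I →
      ‖w‖ ≤ C * (1 + 1 / √‖z‖) := by
  set p : ℝ := -k - 3 / 2 with hp
  have hpm : p ∈ Set.Ioo (-((k + 2 : ℕ) : ℝ)) (-((k + 2 : ℕ) : ℝ) + 1) := by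
    push_cast
    constructor <;> rw [hp] <;> linarith
  set l : ℝ := (logGamma p).re with hl
  refine ⟨k + |l| + 5, by positivity, fun z w hz hw hL => ?_⟩
  have hznorm : 0 < ‖z‖ := norm_pos_iff.2 (by rintro rfl; simp at hz)
  have hsq : 0 < √‖z‖ := Real.sqrt_pos.2 hznorm
  set r : ℝ := 1 / √‖z‖ with hr
  have hr0 : 0 < r := by positivity
  have hu := re_lt_two_of_logGamma_eq hw hL
  have hk0 : (0 : ℝ) ≤ k := by positivity
  have hl0 : 0 ≤ |l| := abs_nonneg l
  rcases le_or_gt 1 w.im with hv | hv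
  · have hw0 : w ≠ 0 := by rintro rfl; simp at hw
    have hw1 : w + 1 ≠ 0 := by
      intro h
      have := congrArg im h
      simp at this
      linarith
    have h6 := norm_Gamma_le_six (s := w + 1 + 1) (by simpa using hv)
      (by simp only [add_re, one_re]; linarith)
    rw [Complex.Gamma_add_one _ hw1, Complex.Gamma_add_one _ hw0, norm_mul, norm_mul,
      norm_Gamma_eq_of_logGamma_eq hz hw hL] at h6
    have h1 : 1 ≤ ‖w + 1‖ := by
      refine le_trans ?_ ((le_abs_self _).trans (abs_im_le_norm (w + 1)))
      simpa using hv
    have h2 : ‖w‖ ≤ 2 * ‖w + 1‖ := by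
      have : ‖w‖ ≤ ‖w + 1‖ + ‖(1 : ℂ)‖ := by simpa using norm_sub_le (w + 1) 1
      rw [norm_one] at this
      linarith
    have h3 : (‖w‖ * √‖z‖) ^ 2 ≤ 4 ^ 2 := by
      rw [mul_pow, Real.sq_sqrt hznorm.le]
      have h4 : ‖w‖ * (‖w‖ * ‖z‖) ≤ 2 * ‖w + 1‖ * (‖w‖ * ‖z‖) := by gcongr
      nlinarith
    have h5 := abs_le_of_sq_le_sq h3 (by norm_num)
    have h7 : ‖w‖ ≤ 4 * r := by
      rw [hr, mul_one_div, le_div_iff₀ hsq]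
      exact (abs_le.1 h5).2.trans le_rfl
    nlinarith
  · have hlog : -Real.log ‖z‖ ≤ 2 * r := by
      have h1 := Real.log_le_sub_one_of_pos hr0
      rw [hr, one_div, Real.log_inv, Real.log_sqrt hznorm.le, ← one_div, ← hr] at h1
      linarith
    have hre : |w.re| ≤ k + 2 + |l| + 2 * r := by
      rw [abs_le]
      refine ⟨?_, by linarith⟩
      by_contra! hlow
      have h := log_norm_sub_mul_im_le hw hL (by omega) hpm
      have harg := arg_nonneg_iff.2 hz.le
      push_cast at h
      have h1 : (z.arg + ((k : ℝ) + 2 - k - 1) * Real.pi) * (w.re - p) ≤ 1 * (w.re - p) := by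
        apply mul_le_mul_of_nonpos_right
        · linarith [Real.pi_gt_three]
        · linarith
      have h2 : (l - Real.log ‖z‖) * w.im ≤ |l| + 2 * r := by
        have h3 : l - Real.log ‖z‖ ≤ |l| + 2 * r := by linarith [le_abs_self l]
        have h4 : (l - Real.log ‖z‖) * w.im ≤ (|l| + 2 * r) * w.im := by gcongr
        have h5 : (|l| + 2 * r) * w.im ≤ (|l| + 2 * r) * 1 := by gcongr
        linarith
      linarith
    have hnorm := norm_le_abs_re_add_abs_im w
    rw [abs_of_pos hw] at hnorm
    nlinarith

theorem exists_norm_add_le_of_logGamma_eq {k : ℕ} (hk : 1 ≤ k) {η : ℝ} (hη : 0 < η) :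
    ∃ R₀ : ℝ, ∀ z w : ℂ, 0 < z.im → 0 < w.im →
      logGamma w = Complex.log z - ((k : ℂ) + 1) * Real.pi * I → R₀ ≤ ‖z‖ → ‖w + k‖ ≤ η := by
  set δ : ℝ := min (η / 2) (1 / 2) with hδ
  have hδ0 : 0 < δ := by positivity
  have hδη : δ ≤ η / 2 := min_le_left _ _
  have hδ2 : δ ≤ 1 / 2 := min_le_right _ _
  set p : ℝ := -k - δ with hp
  set q : ℝ := -k + δ with hq
  have hpm : p ∈ Set.Ioo (-((k + 1 : ℕ) : ℝ)) (-((k + 1 : ℕ) : ℝ) + 1) := by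
    push_cast
    constructor <;> rw [hp] <;> linarith
  have hqm : q ∈ Set.Ioo (-(k : ℝ)) (-(k : ℝ) + 1) := by
    constructor <;> rw [hq] <;> linarith
  set B : ℝ := 6 * (max 1 δ⁻¹) ^ (k + 4) with hB
  refine ⟨max (B + 1) (max (Real.exp (logGamma p).re) (Real.exp (logGamma q).re)),
    fun z w hz hw hL hR => ?_⟩
  have hznorm : 0 < ‖z‖ := norm_pos_iff.2 (by rintro rfl; simp at hz)
  have hRB := (le_max_left _ _).trans hR
  have hRp := ((le_max_left _ _).trans (le_max_right _ _)).trans hR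
  have hRq := ((le_max_right _ _).trans (le_max_right _ _)).trans hR
  rw [← Real.le_log_iff_exp_le hznorm] at hRp hRq
  have harg0 : 0 < z.arg := lt_of_le_of_ne (arg_nonneg_iff.2 hz.le) fun h =>
    hz.ne' (arg_eq_zero_iff.1 h.symm).2
  have hargpi : z.arg < Real.pi := arg_lt_pi_iff.2 (Or.inr hz.ne')
  have hlow : p ≤ w.re := by
    have h := log_norm_sub_mul_im_le hw hL (by omega) hpm
    have h0 : 0 ≤ (Real.log ‖z‖ - (logGamma p).re) * w.im := mul_nonneg (by linarith) hw.le
    push_cast at h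
    have h1 : 0 ≤ z.arg * (w.re - p) := by linarith
    linarith [nonneg_of_mul_nonneg_right h1 harg0]
  have hupp : w.re ≤ q := by
    have h := log_norm_sub_mul_im_le hw hL hk hqm
    have h0 : 0 ≤ (Real.log ‖z‖ - (logGamma q).re) * w.im := mul_nonneg (by linarith) hw.le
    have h1 : 0 ≤ (Real.pi - z.arg) * (q - w.re) := by linarith
    linarith [nonneg_of_mul_nonneg_right h1 (by linarith)]
  have him : w.im ≤ δ := by
    by_contra! h
    have hk1 : (1 : ℝ) ≤ k := by exact_mod_cast hk
    have := norm_Gamma_le_of_le_im hδ0 (k + 4) w h.le (by push_cast; linarith) (by linarith)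
    rw [norm_Gamma_eq_of_logGamma_eq hz hw hL] at this
    linarith
  have hnorm := norm_le_abs_re_add_abs_im (w + k)
  have h1 : |(w + k).re| ≤ δ := by
    rw [abs_le]
    constructor <;> simp <;> linarith
  have h2 : |(w + k).im| ≤ δ := by
    rw [abs_le]
    constructor <;> simp <;> linarith
  linarith

theorem tendsto_arg_add_mul_I {t : ℝ} (ht : t ≠ 0) :
    Tendsto (fun y : ℝ => ((t : ℂ) + y * I).arg) (nhdsWithin 0 (Set.Ioi 0))
      (nhds (t : ℂ).arg) := by
  have hlin : Tendsto (fun y : ℝ => (t : ℂ) + y * I) (nhdsWithin 0 (Set.Ioi 0))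
      (nhdsWithin (t : ℂ) {z : ℂ | 0 ≤ z.im}) := by
    refine tendsto_nhdsWithin_iff.2 ⟨?_, ?_⟩
    · have : Continuous fun y : ℝ => (t : ℂ) + y * I := by fun_prop
      simpa using (this.tendsto 0).mono_left nhdsWithin_le_nhds
    · filter_upwards [self_mem_nhdsWithin] with y hy
      have hy' : (0 : ℝ) < y := hy
      change 0 ≤ ((t : ℂ) + y * I).im
      simpa using hy'.le
  rcases ht.lt_or_gt with h | h
  · exact (continuousWithinAt_arg_of_re_neg_of_im_zero (by simpa using h) (by simp)).tendsto.comp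
      hlin
  · exact (continuousAt_arg (Or.inl (by simpa using h))).tendsto.comp
      (hlin.mono_right nhdsWithin_le_nhds)

theorem tendsto_im_zero_of_logGamma_eq {k : ℕ} {g : ℂ → ℂ}
    (hgim : ∀ z : ℂ, 0 < z.im → 0 < (g z).im)
    (hgL : ∀ z : ℂ, 0 < z.im → logGamma (g z) = Complex.log z - ((k : ℂ) + 1) * Real.pi * I)
    {t p : ℝ} {m : ℕ} (hm : 1 ≤ m) (hp : p ∈ Set.Ioo (-(m : ℝ)) (-m + 1))
    (harg : (t : ℂ).arg = ((k : ℝ) + 1 - m) * Real.pi) (ht : Real.exp (logGamma p).re < |t|) :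
    Tendsto (fun y : ℝ => (g ((t : ℂ) + y * I)).im) (nhdsWithin 0 (Set.Ioi 0)) (nhds 0) := by
  have ht0 : 0 < |t| := (Real.exp_pos _).trans ht
  have hlog : (logGamma p).re < Real.log |t| := (Real.lt_log_iff_exp_lt ht0).2 ht
  obtain ⟨C, hC, hbound⟩ := exists_norm_le_of_logGamma_eq k
  set K : ℝ := C * (1 + 1 / √|t|) + |p| with hK
  have hlim : Tendsto (fun y : ℝ => |((t : ℂ) + y * I).arg - (t : ℂ).arg| * K /
      (Real.log |t| - (logGamma p).re)) (nhdsWithin 0 (Set.Ioi 0)) (nhds 0) := by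
    have h := (tendsto_arg_add_mul_I (abs_pos.1 ht0)).sub_const (t : ℂ).arg
    rw [sub_self] at h
    simpa using (h.abs.mul_const K).div_const (Real.log |t| - (logGamma p).re)
  refine tendsto_of_tendsto_of_tendsto_of_le_of_le' tendsto_const_nhds hlim ?_ ?_
  · filter_upwards [self_mem_nhdsWithin] with y hy
    exact (hgim _ (by simpa using hy)).le
  · filter_upwards [self_mem_nhdsWithin] with y hy
    set z : ℂ := (t : ℂ) + y * I with hzdef
    have hz : 0 < z.im := by simpa [hzdef] using hy
    have hnorm : |t| ≤ ‖z‖ := by simpa [hzdef] using abs_re_le_norm z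
    have hsub : |(g z).re - p| ≤ K := by
      have h1 := hbound z (g z) hz (hgim z hz) (hgL z hz)
      have h2 : C * (1 + 1 / √‖z‖) ≤ C * (1 + 1 / √|t|) := by
        gcongr
      calc |(g z).re - p| ≤ |(g z).re| + |p| := abs_sub _ _
        _ ≤ ‖g z‖ + |p| := by gcongr; exact abs_re_le_norm _
        _ ≤ K := by linarith
    have hmain := log_norm_sub_mul_im_le (hgim z hz) (hgL z hz) hm hp
    rw [le_div_iff₀ (by linarith)]
    have h3 : (g z).im * (Real.log |t| - (logGamma p).re) ≤
        (Real.log ‖z‖ - (logGamma p).re) * (g z).im := by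
      rw [mul_comm]
      have := (hgim z hz).le
      gcongr
    have h4 : z.arg + ((m : ℝ) - k - 1) * Real.pi = z.arg - (t : ℂ).arg := by
      rw [harg]
      ring
    rw [h4] at hmain
    calc _ ≤ (z.arg - (t : ℂ).arg) * ((g z).re - p) := h3.trans hmain
      _ ≤ |z.arg - (t : ℂ).arg| * |(g z).re - p| := by
          rw [← abs_mul]
          exact le_abs_self _
      _ ≤ _ := by gcongr

/-- The integral of `f` along the counterclockwise boundary of the rectangle
`[-R, R] × [0, R]`. -/
noncomputable def upperRectIntegral (f : ℂ → ℂ) (R : ℝ) : ℂ :=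
  (∫ x : ℝ in -R..R, f x) - (∫ x : ℝ in -R..R, f (x + R * I)) +
    I * (∫ y : ℝ in (0 : ℝ)..R, f (R + y * I)) - I * (∫ y : ℝ in (0 : ℝ)..R, f (-R + y * I))

theorem mul_integral_inv_eq_log_sub_log {b v : ℂ} {s₀ s₁ : ℝ}
    (h : ∀ s ∈ Set.uIcc s₀ s₁, b + s * v ∈ slitPlane) :
    v * (∫ s : ℝ in s₀..s₁, (b + s * v)⁻¹) =
      Complex.log (b + s₁ * v) - Complex.log (b + s₀ * v) := by
  rw [← intervalIntegral.integral_const_mul]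
  refine intervalIntegral.integral_eq_sub_of_hasDerivAt
    (f := fun s : ℝ => Complex.log (b + s * v)) (fun s hs => ?_) ?_
  · have h1 : HasDerivAt (fun s : ℝ => b + s * v) (1 * v) s :=
      ((hasDerivAt_id s).ofReal_comp.mul_const v).const_add _
    have h2 := h1.clog_real (h s hs)
    rwa [one_mul, div_eq_mul_inv] at h2
  · refine ContinuousOn.intervalIntegrable (continuousOn_const.mul (ContinuousOn.inv₀ ?_ ?_))
    · exact Continuous.continuousOn (by fun_prop)
    · exact fun s hs => slitPlane_ne_zero (h s hs)

theorem upperRectIntegral_inv_sub {z : ℂ} {R : ℝ} (hz : 0 < z.im) (hzR : z.im < R)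
    (hre : |z.re| < R) : upperRectIntegral (fun ζ => (ζ - z)⁻¹) R = 2 * Real.pi * I := by
  obtain ⟨hre1, hre2⟩ := abs_lt.1 hre
  have hbot : (∫ x : ℝ in -R..R, ((x : ℂ) - z)⁻¹) =
      Complex.log (-z + R) - Complex.log (-z - R) := by
    have h := mul_integral_inv_eq_log_sub_log (b := -z) (v := 1) (s₀ := -R) (s₁ := R)
      fun s _ => Or.inr (by simpa using hz.ne')
    rw [one_mul] at h
    simp only [mul_one, ofReal_neg] at h
    rw [sub_eq_add_neg (-z) (R : ℂ), ← h]
    simp only [neg_add_eq_sub]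
  have htop : (∫ x : ℝ in -R..R, ((x : ℂ) + R * I - z)⁻¹) =
      Complex.log (R * I - z + R) - Complex.log (R * I - z - R) := by
    have h := mul_integral_inv_eq_log_sub_log (b := R * I - z) (v := 1) (s₀ := -R) (s₁ := R)
      fun s _ => Or.inr (by simpa using (sub_pos.2 hzR).ne')
    rw [one_mul] at h
    simp only [mul_one, ofReal_neg] at h
    rw [sub_eq_add_neg (R * I - z) (R : ℂ), ← h]
    refine intervalIntegral.integral_congr fun x _ => ?_
    congr 1
    ring
  have hright : I * (∫ y : ℝ in (0 : ℝ)..R, ((R : ℂ) + y * I - z)⁻¹) =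
      Complex.log (R * I - z + R) - Complex.log (-z + R) := by
    have h := mul_integral_inv_eq_log_sub_log (b := R - z) (v := I) (s₀ := 0) (s₁ := R)
      fun s _ => Or.inl (by simpa using hre2)
    have e1 : (R : ℂ) - z + R * I = R * I - z + R := by ring
    have e2 : (R : ℂ) - z + (0 : ℝ) * I = -z + R := by push_cast; ring
    rw [e1, e2] at h
    rw [← h]
    congr 1
    refine intervalIntegral.integral_congr fun y _ => ?_
    congr 1
    ring
  have hleft : I * (∫ y : ℝ in (0 : ℝ)..R, (-(R : ℂ) + y * I - z)⁻¹) =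
      Complex.log (-(R * I - z - R)) - Complex.log (-(-z - R)) := by
    have h := mul_integral_inv_eq_log_sub_log (b := R + z) (v := -I) (s₀ := 0) (s₁ := R)
      fun s _ => Or.inl (by simp; linarith)
    have e1 : (R : ℂ) + z + R * -I = -(R * I - z - R) := by ring
    have e2 : (R : ℂ) + z + (0 : ℝ) * -I = -(-z - R) := by push_cast; ring
    rw [e1, e2] at h
    rw [← h, neg_mul, ← mul_neg, ← intervalIntegral.integral_neg]
    congr 1
    refine intervalIntegral.integral_congr fun y _ => ?_
    change (-(R : ℂ) + y * I - z)⁻¹ = -((R : ℂ) + z + y * -I)⁻¹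
    rw [← inv_neg]
    congr 1
    ring
  have hd : Complex.log (R * I - z - R) - Complex.log (-(R * I - z - R)) = Real.pi * I := by
    rw [Complex.log, Complex.log, norm_neg, arg_neg_eq_arg_sub_pi_of_im_pos (by simpa using hzR)]
    push_cast
    ring
  have hc : Complex.log (-(-z - R)) - Complex.log (-z - R) = Real.pi * I := by
    rw [Complex.log, Complex.log, norm_neg, arg_neg_eq_arg_add_pi_of_im_neg (by simpa using hz)]
    push_cast
    ring
  rw [upperRectIntegral, hbot, htop, hright, hleft]
  linear_combination hd + hc

theorem upperRectIntegral_eq_zero {f : ℂ → ℂ} {R : ℝ} (hR : 0 ≤ R)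
    (hf : DifferentiableOn ℂ f {ζ : ℂ | 0 ≤ ζ.im}) : upperRectIntegral f R = 0 := by
  have h := Complex.integral_boundary_rect_eq_zero_of_differentiableOn f (-R : ℝ)
    ((R : ℂ) + R * I) (hf.mono ?_)
  · simpa [upperRectIntegral] using h
  · intro ζ hζ
    have h2 := hζ.2
    simp only [Set.mem_preimage, ofReal_im, add_im, mul_im, ofReal_re, I_im, mul_one, I_re,
      mul_zero, add_zero, zero_add, Set.uIcc_of_le hR] at h2
    exact h2.1

theorem upperRectIntegral_add {f₁ f₂ : ℂ → ℂ} {z : ℂ} {R : ℝ} (hz : 0 < z.im) (hzR : z.im < R)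
    (hre : |z.re| < R) (h₁ : ContinuousOn f₁ {ζ : ℂ | 0 ≤ ζ.im ∧ ζ ≠ z})
    (h₂ : ContinuousOn f₂ {ζ : ℂ | 0 ≤ ζ.im ∧ ζ ≠ z}) :
    upperRectIntegral (fun ζ => f₁ ζ + f₂ ζ) R =
      upperRectIntegral f₁ R + upperRectIntegral f₂ R := by
  have hR : 0 < R := hz.trans hzR
  have key : ∀ {f : ℂ → ℂ}, ContinuousOn f {ζ : ℂ | 0 ≤ ζ.im ∧ ζ ≠ z} →
      IntervalIntegrable (fun x : ℝ => f x) MeasureTheory.volume (-R) R ∧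
      IntervalIntegrable (fun x : ℝ => f (x + R * I)) MeasureTheory.volume (-R) R ∧
      IntervalIntegrable (fun y : ℝ => f (R + y * I)) MeasureTheory.volume 0 R ∧
      IntervalIntegrable (fun y : ℝ => f (-R + y * I)) MeasureTheory.volume 0 R := by
    intro f hf
    refine ⟨?_, ?_, ?_, ?_⟩ <;>
      refine ContinuousOn.intervalIntegrable (hf.comp (Continuous.continuousOn (by fun_prop)) ?_) <;>
      intro s hs <;> refine ⟨?_, fun h => ?_⟩
    · simp
    · have := congrArg im h
      simp at this
      linarith
    · simpa using hR.le
    · have := congrArg im h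
      simp at this
      linarith
    · rw [Set.uIcc_of_le hR.le] at hs
      simpa using hs.1
    · have := congrArg re h
      simp at this
      linarith [(abs_lt.1 hre).2]
    · rw [Set.uIcc_of_le hR.le] at hs
      simpa using hs.1
    · have := congrArg re h
      simp at this
      linarith [(abs_lt.1 hre).1]
  obtain ⟨a₁, b₁, c₁, d₁⟩ := key h₁
  obtain ⟨a₂, b₂, c₂, d₂⟩ := key h₂
  simp only [upperRectIntegral]
  rw [intervalIntegral.integral_add a₁ a₂, intervalIntegral.integral_add b₁ b₂,
    intervalIntegral.integral_add c₁ c₂, intervalIntegral.integral_add d₁ d₂]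
  ring

theorem upperRectIntegral_congr {f₁ f₂ : ℂ → ℂ} {z : ℂ} {R : ℝ} (hz : 0 < z.im) (hzR : z.im < R)
    (hre : |z.re| < R) (h : ∀ ζ, ζ ≠ z → f₁ ζ = f₂ ζ) :
    upperRectIntegral f₁ R = upperRectIntegral f₂ R := by
  have h1 : ∀ x : ℝ, f₁ x = f₂ x := fun x => h _ fun e => by
    have := congrArg im e
    simp at this
    linarith
  have h2 : ∀ x : ℝ, f₁ (x + R * I) = f₂ (x + R * I) := fun x => h _ fun e => by
    have := congrArg im e
    simp at this
    linarith
  have h3 : ∀ y : ℝ, f₁ (R + y * I) = f₂ (R + y * I) := fun y => h _ fun e => by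
    have := congrArg re e
    simp at this
    linarith [(abs_lt.1 hre).2]
  have h4 : ∀ y : ℝ, f₁ (-R + y * I) = f₂ (-R + y * I) := fun y => h _ fun e => by
    have := congrArg re e
    simp at this
    linarith [(abs_lt.1 hre).1]
  simp only [upperRectIntegral, h1, h2, h3, h4]

theorem upperRectIntegral_const_mul (c : ℂ) (f : ℂ → ℂ) (R : ℝ) :
    upperRectIntegral (fun ζ => c * f ζ) R = c * upperRectIntegral f R := by
  simp only [upperRectIntegral, intervalIntegral.integral_const_mul]
  ring

theorem upperRectIntegral_div_sub {F : ℂ → ℂ} {ε : ℝ} (hε : 0 < ε)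
    (hF : DifferentiableOn ℂ F {ζ : ℂ | -ε < ζ.im}) {z : ℂ} {R : ℝ} (hz : 0 < z.im)
    (hzR : z.im < R) (hre : |z.re| < R) :
    upperRectIntegral (fun ζ => F ζ / (ζ - z)) R = 2 * Real.pi * I * F z := by
  have hopen : IsOpen {ζ : ℂ | -ε < ζ.im} := isOpen_lt continuous_const continuous_im
  have hmem : {ζ : ℂ | -ε < ζ.im} ∈ nhds z :=
    hopen.mem_nhds (show -ε < z.im by linarith)
  have hsub : {ζ : ℂ | 0 ≤ ζ.im} ⊆ {ζ : ℂ | -ε < ζ.im} := fun ζ hζ => by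
    have hζ' : 0 ≤ ζ.im := hζ
    change -ε < ζ.im
    linarith
  have hslope : DifferentiableOn ℂ (dslope F z) {ζ : ℂ | 0 ≤ ζ.im} :=
    ((differentiableOn_dslope hmem).2 hF).mono hsub
  have hinv : ContinuousOn (fun ζ : ℂ => F z * (ζ - z)⁻¹) {ζ : ℂ | 0 ≤ ζ.im ∧ ζ ≠ z} :=
    continuousOn_const.mul (ContinuousOn.inv₀ (Continuous.continuousOn (by fun_prop))
      fun ζ hζ => sub_ne_zero.2 hζ.2)
  rw [upperRectIntegral_congr (f₂ := fun ζ => dslope F z ζ + F z * (ζ - z)⁻¹) hz hzR hre,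
    upperRectIntegral_add hz hzR hre (hslope.continuousOn.mono fun ζ hζ => hζ.1) hinv,
    upperRectIntegral_eq_zero (hz.trans hzR).le hslope, upperRectIntegral_const_mul,
    upperRectIntegral_inv_sub hz hzR hre]
  · ring
  · intro ζ hζ
    have := sub_ne_zero.2 hζ
    rw [dslope_of_ne _ hζ, slope_def_field]
    field_simp
    ring

theorem norm_upperRectIntegral_sub_le {f : ℂ → ℂ} {R M : ℝ} (hR : 0 < R)
    (hf : ∀ ζ : ℂ, 0 ≤ ζ.im → R ≤ ‖ζ‖ → ‖f ζ‖ ≤ M) :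
    ‖upperRectIntegral f R - ∫ x : ℝ in -R..R, f x‖ ≤ 4 * R * M := by
  have htop : ‖∫ x : ℝ in -R..R, f (x + R * I)‖ ≤ M * |R - -R| := by
    refine intervalIntegral.norm_integral_le_of_norm_le_const fun x _ => hf _ ?_ ?_
    · simpa using hR.le
    · simpa [abs_of_pos hR] using abs_im_le_norm ((x : ℂ) + R * I)
  have hright : ‖∫ y : ℝ in (0 : ℝ)..R, f (R + y * I)‖ ≤ M * |R - 0| := by
    refine intervalIntegral.norm_integral_le_of_norm_le_const fun y hy => hf _ ?_ ?_
    · rw [Set.uIoc_of_le hR.le] at hy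
      simpa using hy.1.le
    · simpa [abs_of_pos hR] using abs_re_le_norm ((R : ℂ) + y * I)
  have hleft : ‖∫ y : ℝ in (0 : ℝ)..R, f (-R + y * I)‖ ≤ M * |R - 0| := by
    refine intervalIntegral.norm_integral_le_of_norm_le_const fun y hy => hf _ ?_ ?_
    · rw [Set.uIoc_of_le hR.le] at hy
      simpa using hy.1.le
    · simpa [abs_of_pos hR] using abs_re_le_norm (-(R : ℂ) + y * I)
  rw [sub_zero, abs_of_pos hR] at hright hleft
  rw [abs_of_pos (by linarith)] at htop
  have he : upperRectIntegral f R - ∫ x : ℝ in -R..R, f x =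
      -(∫ x : ℝ in -R..R, f (x + R * I)) + I * (∫ y : ℝ in (0 : ℝ)..R, f (R + y * I)) -
        I * (∫ y : ℝ in (0 : ℝ)..R, f (-R + y * I)) := by
    rw [upperRectIntegral]
    ring
  rw [he]
  refine (norm_sub_le _ _).trans ((add_le_add_left (norm_add_le _ _) _).trans ?_)
  rw [norm_neg, norm_mul, norm_mul, norm_I, one_mul, one_mul]
  linarith

theorem norm_pi_mul_sub_integral_im_le {F : ℂ → ℂ} {ε η R : ℝ} (hε : 0 < ε)
    (hF : DifferentiableOn ℂ F {ζ : ℂ | -ε < ζ.im}) {z : ℂ} (hz : 0 < z.im) (hR : 2 * ‖z‖ ≤ R)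
    (hη : ∀ ζ : ℂ, 0 ≤ ζ.im → R ≤ ‖ζ‖ → ‖F ζ‖ ≤ η) :
    ‖Real.pi * F z - ∫ t : ℝ in -R..R, ((F t).im : ℂ) / (t - z)‖ ≤ 8 * η := by
  have hz0 : 0 < ‖z‖ := norm_pos_iff.2 (by rintro rfl; simp at hz)
  have hR0 : 0 < R := by linarith
  have hzim : z.im < R := by linarith [(le_abs_self _).trans (abs_im_le_norm z)]
  have hzre : |z.re| < R := by linarith [abs_re_le_norm z]
  have hsub : {ζ : ℂ | 0 ≤ ζ.im} ⊆ {ζ : ℂ | -ε < ζ.im} := fun ζ hζ => by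
    have hζ' : 0 ≤ ζ.im := hζ
    change -ε < ζ.im
    linarith
  have hreal : ∀ t : ℝ, (t : ℂ) ∈ {ζ : ℂ | -ε < ζ.im} := fun t => by
    change -ε < (t : ℂ).im
    simpa using hε
  set zb : ℂ := (starRingEnd ℂ) z with hzb
  have hzbim : zb.im = -z.im := conj_im z
  have herr : ∀ c : ℂ, ‖c‖ = ‖z‖ → ‖upperRectIntegral (fun ζ => F ζ / (ζ - c)) R -
      ∫ x : ℝ in -R..R, F x / ((x : ℂ) - c)‖ ≤ 8 * η := by
    intro c hc
    have h := norm_upperRectIntegral_sub_le (f := fun ζ => F ζ / (ζ - c)) (M := η / (R / 2)) hR0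
      fun ζ h0 hζ => ?_
    · refine h.trans_eq ?_
      field_simp
      ring
    · have h1 : R / 2 ≤ ‖ζ - c‖ := by
        have := norm_sub_norm_le ζ c
        linarith
      rw [norm_div]
      exact div_le_div₀ ((norm_nonneg _).trans (hη ζ h0 hζ)) (hη ζ h0 hζ) (by positivity) h1
  have h1 := upperRectIntegral_div_sub hε hF hz hzim hzre
  have h2 : upperRectIntegral (fun ζ => F ζ / (ζ - zb)) R = 0 := by
    refine upperRectIntegral_eq_zero hR0.le ((hF.mono hsub).div (by fun_prop) fun ζ hζ h => ?_)
    have hζ' : 0 ≤ ζ.im := hζ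
    have := congrArg im h
    rw [sub_im, hzbim] at this
    simp at this
    linarith
  have e1 := herr z rfl
  have e2 := herr zb (by rw [hzb, norm_conj])
  have hcontF : Continuous fun t : ℝ => F t :=
    hF.continuousOn.comp_continuous continuous_ofReal hreal
  have hne : ∀ t : ℝ, (t : ℂ) - z ≠ 0 := fun t h => by
    have := congrArg im h
    simp at this
    linarith
  have hi1 : IntervalIntegrable (fun t : ℝ => F t / ((t : ℂ) - z)) MeasureTheory.volume (-R) R :=
    (hcontF.div (by fun_prop) hne).intervalIntegrable _ _
  have hi2 : IntervalIntegrable (fun t : ℝ => (starRingEnd ℂ) (F t) / ((t : ℂ) - z))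
      MeasureTheory.volume (-R) R :=
    ((continuous_conj.comp hcontF).div (by fun_prop) hne).intervalIntegrable _ _
  have hconj : (starRingEnd ℂ) (∫ x : ℝ in -R..R, F x / ((x : ℂ) - zb)) =
      ∫ x : ℝ in -R..R, (starRingEnd ℂ) (F x) / ((x : ℂ) - z) := by
    rw [intervalIntegral.intervalIntegral_eq_integral_uIoc,
      intervalIntegral.intervalIntegral_eq_integral_uIoc, Complex.real_smul, Complex.real_smul,
      map_mul, conj_ofReal, ← integral_conj]
    simp [hzb]
  have him : (2 * I) * ∫ t : ℝ in -R..R, ((F t).im : ℂ) / (t - z) =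
      (∫ x : ℝ in -R..R, F x / ((x : ℂ) - z)) -
        ∫ x : ℝ in -R..R, (starRingEnd ℂ) (F x) / ((x : ℂ) - z) := by
    rw [← intervalIntegral.integral_sub hi1 hi2, ← intervalIntegral.integral_const_mul]
    refine intervalIntegral.integral_congr fun t _ => ?_
    change 2 * I * (((F t).im : ℂ) / (t - z)) =
      F t / ((t : ℂ) - z) - (starRingEnd ℂ) (F t) / ((t : ℂ) - z)
    rw [← sub_div, sub_conj]
    push_cast
    ring
  have hfinal : (2 * I) * (Real.pi * F z - ∫ t : ℝ in -R..R, ((F t).im : ℂ) / (t - z)) =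
      (upperRectIntegral (fun ζ => F ζ / (ζ - z)) R - ∫ x : ℝ in -R..R, F x / ((x : ℂ) - z)) -
      (starRingEnd ℂ) (upperRectIntegral (fun ζ => F ζ / (ζ - zb)) R -
        ∫ x : ℝ in -R..R, F x / ((x : ℂ) - zb)) := by
    rw [mul_sub, him, h1, h2, map_sub, hconj, map_zero]
    ring
  have hn := congrArg norm hfinal
  rw [norm_mul, norm_mul, norm_I, Complex.norm_two, mul_one] at hn
  have hle := norm_sub_le (upperRectIntegral (fun ζ => F ζ / (ζ - z)) R -
    ∫ x : ℝ in -R..R, F x / ((x : ℂ) - z)) ((starRingEnd ℂ)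
      (upperRectIntegral (fun ζ => F ζ / (ζ - zb)) R - ∫ x : ℝ in -R..R, F x / ((x : ℂ) - zb)))
  rw [norm_conj] at hle
  linarith

theorem intervalIntegrable_one_div_sqrt_abs (a b : ℝ) :
    IntervalIntegrable (fun t : ℝ => 1 / √|t|) MeasureTheory.volume a b := by
  have hpos : ∀ c : ℝ, 0 ≤ c →
      IntervalIntegrable (fun t : ℝ => 1 / √|t|) MeasureTheory.volume 0 c := by
    intro c hc
    refine (intervalIntegral.intervalIntegrable_rpow' (a := 0) (b := c) (r := -(1 / 2))
      (by norm_num)).congr fun t ht => ?_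
    rw [Set.uIoc_of_le hc] at ht
    rw [abs_of_pos ht.1, Real.sqrt_eq_rpow, Real.rpow_neg ht.1.le, one_div (t ^ (1 / 2 : ℝ))]
  have hzero : ∀ c : ℝ, IntervalIntegrable (fun t : ℝ => 1 / √|t|) MeasureTheory.volume 0 c := by
    intro c
    rcases le_total 0 c with hc | hc
    · exact hpos c hc
    · have h := (hpos (-c) (by linarith)).comp_mul_left (c := -1)
      simpa using h
  exact (hzero a).symm.trans (hzero b)

theorem norm_le_norm_add_mul_I {ζ : ℂ} (hζ : 0 ≤ ζ.im) {y : ℝ} (hy : 0 ≤ y) :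
    ‖ζ‖ ≤ ‖ζ + y * I‖ := by
  rw [norm_eq_sqrt_sq_add_sq, norm_eq_sqrt_sq_add_sq]
  apply Real.sqrt_le_sqrt
  simp only [add_re, mul_re, ofReal_re, I_re, mul_zero, ofReal_im, I_im, mul_one, sub_self,
    add_zero, add_im, mul_im]
  gcongr
  linarith

section HalfPlane

variable {g : ℂ → ℂ} {C : ℝ}

theorem continuous_im_comp_add_mul_I (hg : DifferentiableOn ℂ g {z : ℂ | 0 < z.im}) {y : ℝ}
    (hy : 0 < y) : Continuous fun t : ℝ => (g ((t : ℂ) + y * I)).im := by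
  refine continuous_im.comp (hg.continuousOn.comp_continuous (by fun_prop) fun t => ?_)
  change 0 < ((t : ℂ) + y * I).im
  simpa using hy

theorem abs_im_le_of_norm_le
    (hbound : ∀ z : ℂ, 0 < z.im → ‖g z‖ ≤ C * (1 + 1 / √‖z‖)) (hC : 0 ≤ C) {t : ℝ} (ht : t ≠ 0)
    {y : ℝ} (hy : 0 < y) : |(g ((t : ℂ) + y * I)).im| ≤ C * (1 + 1 / √|t|) := by
  refine (abs_im_le_norm _).trans ((hbound _ (by simpa using hy)).trans ?_)
  have hnorm : |t| ≤ ‖(t : ℂ) + y * I‖ := by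
    simpa using norm_le_norm_add_mul_I (ζ := t) (by simp) hy.le
  have ht' : 0 < |t| := abs_pos.2 ht
  gcongr

theorem integrableOn_of_tendsto_im (hg : DifferentiableOn ℂ g {z : ℂ | 0 < z.im})
    (hbound : ∀ z : ℂ, 0 < z.im → ‖g z‖ ≤ C * (1 + 1 / √‖z‖)) (hC : 0 ≤ C) {a b : ℝ}
    (hab : a ≤ b) {d : ℝ → ℝ}
    (hd : ∀ t ∈ Set.Icc a b \ {0}, Tendsto (fun y : ℝ => (g ((t : ℂ) + y * I)).im)
      (nhdsWithin 0 (Set.Ioi 0)) (nhds (d t))) :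
    MeasureTheory.IntegrableOn d (Set.Icc a b) := by
  have hae : ∀ᵐ t ∂(MeasureTheory.volume.restrict (Set.Icc a b)), t ∈ Set.Icc a b \ {0} := by
    have h0 : ∀ᵐ t : ℝ ∂(MeasureTheory.volume.restrict (Set.Icc a b)), t ≠ 0 :=
      MeasureTheory.Measure.ae_ne _ 0
    filter_upwards [h0, MeasureTheory.ae_restrict_mem measurableSet_Icc] with t h1 h2
    exact ⟨h2, h1⟩
  have hdom : MeasureTheory.IntegrableOn (fun t : ℝ => C * (1 + 1 / √|t|)) (Set.Icc a b) := by
    rw [integrableOn_Icc_iff_integrableOn_Ioc, ← intervalIntegrable_iff_integrableOn_Ioc_of_le hab]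
    exact (intervalIntegrable_const.add (intervalIntegrable_one_div_sqrt_abs a b)).const_mul C
  have hseq : Tendsto (fun n : ℕ => 1 / ((n : ℝ) + 1)) atTop (nhdsWithin 0 (Set.Ioi 0)) :=
    tendsto_nhdsWithin_iff.2 ⟨tendsto_one_div_add_atTop_nhds_zero_nat,
      Eventually.of_forall fun n => Set.mem_Ioi.2 (by positivity)⟩
  refine MeasureTheory.Integrable.mono' hdom ?_ ?_
  · refine aestronglyMeasurable_of_tendsto_ae atTop
      (f := fun (n : ℕ) (t : ℝ) => (g ((t : ℂ) + ((1 / ((n : ℝ) + 1) : ℝ) : ℂ) * I)).im)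
      (fun n => (continuous_im_comp_add_mul_I hg (by positivity)).aestronglyMeasurable) ?_
    filter_upwards [hae] with t ht
    exact (hd t ht).comp hseq
  · filter_upwards [hae] with t ht
    rw [Real.norm_eq_abs]
    refine le_of_tendsto (hd t ht).abs ?_
    filter_upwards [self_mem_nhdsWithin] with y hy
    exact abs_im_le_of_norm_le hbound hC ht.2 hy

theorem tendsto_integral_im_div_sub (hg : DifferentiableOn ℂ g {z : ℂ | 0 < z.im})
    (hbound : ∀ z : ℂ, 0 < z.im → ‖g z‖ ≤ C * (1 + 1 / √‖z‖)) (hC : 0 ≤ C) {e : ℝ → ℝ}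
    (he : ∀ t : ℝ, t ≠ 0 → Tendsto (fun y : ℝ => (g ((t : ℂ) + y * I)).im)
      (nhdsWithin 0 (Set.Ioi 0)) (nhds (e t))) {z : ℂ} (hz : 0 < z.im) (a b : ℝ) :
    Tendsto (fun y : ℝ => ∫ t : ℝ in a..b, ((g ((t : ℂ) + y * I)).im : ℂ) / (t - z))
      (nhdsWithin 0 (Set.Ioi 0)) (nhds (∫ t : ℝ in a..b, (e t : ℂ) / (t - z))) := by
  have hne : ∀ t : ℝ, (t : ℂ) - z ≠ 0 := fun t h => by
    have := congrArg im h
    simp at this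
    linarith
  have hnorm : ∀ t : ℝ, z.im ≤ ‖(t : ℂ) - z‖ := fun t => by
    simpa [abs_of_pos hz] using abs_im_le_norm ((t : ℂ) - z)
  have hae : ∀ᵐ t : ℝ, t ≠ 0 := MeasureTheory.Measure.ae_ne _ 0
  refine intervalIntegral.tendsto_integral_filter_of_dominated_convergence
    (fun t => C * (1 + 1 / √|t|) / z.im) ?_ ?_ ?_ ?_
  · filter_upwards [self_mem_nhdsWithin] with y hy
    exact ((continuous_ofReal.comp (continuous_im_comp_add_mul_I hg hy)).div (by fun_prop)
      hne).aestronglyMeasurable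
  · filter_upwards [self_mem_nhdsWithin] with y hy
    filter_upwards [hae] with t ht _
    rw [norm_div, Complex.norm_real, Real.norm_eq_abs]
    exact div_le_div₀ (by positivity) (abs_im_le_of_norm_le hbound hC ht hy) hz (hnorm t)
  · exact ((intervalIntegrable_const.add
      (intervalIntegrable_one_div_sqrt_abs a b)).const_mul C).div_const _
  · filter_upwards [hae] with t ht _
    exact ((continuous_ofReal.tendsto _).comp (he t ht)).div_const _

theorem norm_pi_mul_sub_integral_boundary_le (hg : DifferentiableOn ℂ g {z : ℂ | 0 < z.im})
    (hbound : ∀ z : ℂ, 0 < z.im → ‖g z‖ ≤ C * (1 + 1 / √‖z‖)) (hC : 0 ≤ C) {e : ℝ → ℝ}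
    (he : ∀ t : ℝ, t ≠ 0 → Tendsto (fun y : ℝ => (g ((t : ℂ) + y * I)).im)
      (nhdsWithin 0 (Set.Ioi 0)) (nhds (e t))) {z : ℂ} (hz : 0 < z.im) {c R η : ℝ}
    (hR : 2 * ‖z‖ ≤ R) (hη : ∀ ζ : ℂ, 0 < ζ.im → R ≤ ‖ζ‖ → ‖g ζ + c‖ ≤ η) :
    ‖Real.pi * (g z + c) - ∫ t : ℝ in -R..R, (e t : ℂ) / (t - z)‖ ≤ 8 * η := by
  have hlim := tendsto_integral_im_div_sub hg hbound hC he hz (-R) R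
  have hgz : Tendsto (fun y : ℝ => g (z + y * I)) (nhdsWithin 0 (Set.Ioi 0)) (nhds (g z)) := by
    have hopen : IsOpen {z : ℂ | 0 < z.im} := isOpen_lt continuous_const continuous_im
    have h1 : ContinuousAt g z := (hg.differentiableAt (hopen.mem_nhds hz)).continuousAt
    have h2 : Tendsto (fun y : ℝ => z + y * I) (nhdsWithin 0 (Set.Ioi 0)) (nhds z) := by
      have : Continuous fun y : ℝ => z + y * I := by fun_prop
      simpa using (this.tendsto 0).mono_left nhdsWithin_le_nhds
    exact h1.tendsto.comp h2
  refine le_of_tendsto (((hgz.add_const (c : ℂ)).const_mul (Real.pi : ℂ)).sub hlim).norm ?_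
  filter_upwards [self_mem_nhdsWithin] with y hy
  have hy0 : 0 < y := hy
  have hF : DifferentiableOn ℂ (fun ζ => g (ζ + y * I) + c) {ζ : ℂ | -y < ζ.im} := by
    refine (hg.comp (by fun_prop) fun ζ hζ => ?_).add_const _
    have hζ' : -y < ζ.im := hζ
    change 0 < (ζ + y * I).im
    simp
    linarith
  have h := norm_pi_mul_sub_integral_im_le (η := η) hy0 hF hz hR fun ζ h0 hζ => ?_
  · simpa using h
  · refine hη _ ?_ (hζ.trans (norm_le_norm_add_mul_I h0 hy0.le))
    simp
    linarith

end HalfPlane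

/-- Let `k ≥ 1` be odd and `d_k(t) = (1/π)·lim_{y→0⁺} Im g_k(t+iy)` on
`I_k ∖ {0}`.  Then `d_k` is Lebesgue integrable on `I_k` and for `z ∈ ℂ₊`,
`g_k(z) = ∫_{Γ(x_k)}^{Γ(x_{k+1})} d_k(t)/(t − z) dt − k`. -/
theorem gk_integral_representation_odd (x : ℕ → ℝ)
    (hxk : ∀ j : ℕ, 1 ≤ j → x j ∈ Set.Ioo (-(j : ℝ)) (-(j : ℝ) + 1) ∧
      deriv Real.Gamma (x j) = 0)
    (k : ℕ) (hk1 : 1 ≤ k) (hkodd : Odd k) (g : ℂ → ℂ)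
    (hg : DifferentiableOn ℂ g {z : ℂ | 0 < z.im})
    (hgim : ∀ z : ℂ, 0 < z.im → 0 < (g z).im)
    (hgL : ∀ z : ℂ, 0 < z.im →
      logGamma (g z) = Complex.log z - ((k : ℂ) + 1) * Real.pi * I)
    (d : ℝ → ℝ)
    (hd : ∀ t ∈ Set.Icc (Real.Gamma (x k)) (Real.Gamma (x (k + 1))) \ {0},
      Tendsto (fun y : ℝ => (1 / Real.pi) * (g ((t : ℂ) + y * I)).im)
        (nhdsWithin 0 (Set.Ioi 0)) (nhds (d t))) :
    MeasureTheory.IntegrableOn d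
      (Set.Icc (Real.Gamma (x k)) (Real.Gamma (x (k + 1)))) ∧
    ∀ z : ℂ, 0 < z.im →
      g z = (∫ t in Real.Gamma (x k)..Real.Gamma (x (k + 1)),
        (d t : ℂ) / ((t : ℂ) - z)) - (k : ℂ) := by
  have hxk0 := (hxk k hk1).1
  have hxk1 := (hxk (k + 1) (by omega)).1
  have hGk : Real.Gamma (x k) = -Real.exp (logGamma (x k)).re := by
    rw [Gamma_eq_neg_one_pow_mul_exp_re_logGamma hk1 hxk0, hkodd.neg_one_pow, neg_one_mul]
  have hGk1 : Real.Gamma (x (k + 1)) = Real.exp (logGamma (x (k + 1))).re := by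
    rw [Gamma_eq_neg_one_pow_mul_exp_re_logGamma (by omega) hxk1, hkodd.add_one.neg_one_pow,
      one_mul]
  set a := Real.Gamma (x k)
  set b := Real.Gamma (x (k + 1))
  have ha0 : a < 0 := by
    rw [hGk]
    exact neg_neg_of_pos (Real.exp_pos _)
  have hb0 : 0 < b := by
    rw [hGk1]
    exact Real.exp_pos _
  obtain ⟨C, hC, hCbound⟩ := exists_norm_le_of_logGamma_eq k
  have hbound : ∀ z : ℂ, 0 < z.im → ‖g z‖ ≤ C * (1 + 1 / √‖z‖) := fun z hz =>
    hCbound z (g z) hz (hgim z hz) (hgL z hz)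
  have hlim : ∀ t ∈ Set.Icc a b \ {0}, Tendsto (fun y : ℝ => (g ((t : ℂ) + y * I)).im)
      (nhdsWithin 0 (Set.Ioi 0)) (nhds (Real.pi * d t)) := by
    intro t ht
    refine ((hd t ht).const_mul Real.pi).congr fun y => ?_
    field_simp [Real.pi_ne_zero]
  refine ⟨?_, fun z hz => ?_⟩
  · have h := (integrableOn_of_tendsto_im hg hbound hC.le (ha0.trans hb0).le hlim).const_mul
      Real.pi⁻¹
    simpa [MeasureTheory.IntegrableOn, ← mul_assoc, Real.pi_ne_zero] using h
  have hlim' : ∀ t : ℝ, t ≠ 0 → Tendsto (fun y : ℝ => (g ((t : ℂ) + y * I)).im)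
      (nhdsWithin 0 (Set.Ioi 0))
      (nhds ((Set.Icc a b).indicator (fun t => Real.pi * d t) t)) := by
    intro t ht
    by_cases hmem : t ∈ Set.Icc a b
    · rw [Set.indicator_of_mem hmem]
      exact hlim t ⟨hmem, ht⟩
    · rw [Set.indicator_of_notMem hmem]
      rcases lt_or_ge t a with hta | hta
      · have ht0 : t < 0 := hta.trans ha0
        refine tendsto_im_zero_of_logGamma_eq hgim hgL hk1 hxk0 ?_ ?_
        · rw [arg_ofReal_of_neg ht0]
          ring
        · rw [abs_of_neg ht0]
          linarith
      · have htb : b < t := lt_of_not_ge fun h => hmem ⟨hta, h⟩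
        have ht0 : 0 < t := hb0.trans htb
        refine tendsto_im_zero_of_logGamma_eq hgim hgL (by omega) hxk1 ?_ ?_
        · rw [arg_ofReal_of_nonneg ht0.le]
          push_cast
          ring
        · rwa [abs_of_pos ht0, ← hGk1]
  have hclose : ∀ η : ℝ, 0 < η →
      ‖Real.pi * (g z + k) - Real.pi * ∫ t in a..b, (d t : ℂ) / ((t : ℂ) - z)‖ ≤ η := by
    intro η hη
    obtain ⟨R₀, hR₀⟩ := exists_norm_add_le_of_logGamma_eq hk1 (η := η / 8) (by positivity)
    obtain ⟨R, hR⟩ := Filter.eventually_atTop.1 ((eventually_ge_atTop R₀).and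
      ((eventually_ge_atTop (2 * ‖z‖)).and ((eventually_gt_atTop (-a)).and
        (eventually_gt_atTop b))))
    obtain ⟨h0, h1, h2, h3⟩ := hR R le_rfl
    have hmain := norm_pi_mul_sub_integral_boundary_le hg hbound hC.le hlim' hz (c := k) h1
      fun ζ hζ hn => by
        simpa using hR₀ ζ (g ζ) hζ (hgim ζ hζ) (hgL ζ hζ) (h0.trans hn)
    have hintegral : ∫ t : ℝ in -R..R,
        (((Set.Icc a b).indicator (fun t => Real.pi * d t) t : ℝ) : ℂ) / ((t : ℂ) - z) =
        Real.pi * ∫ t in a..b, (d t : ℂ) / ((t : ℂ) - z) := by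
      have hfun : (fun t : ℝ =>
          (((Set.Icc a b).indicator (fun t => Real.pi * d t) t : ℝ) : ℂ) / ((t : ℂ) - z)) =
          (Set.Icc a b).indicator fun t : ℝ => (Real.pi : ℂ) * ((d t : ℂ) / ((t : ℂ) - z)) := by
        funext t
        by_cases hmem : t ∈ Set.Icc a b
        · simp only [Set.indicator_of_mem hmem, ofReal_mul]
          ring
        · simp [Set.indicator_of_notMem hmem]
      have hsub : Set.Ioc (-R) R ∩ Set.Icc a b = Set.Icc a b :=
        Set.inter_eq_right.2 fun t ht => ⟨by linarith [ht.1], by linarith [ht.2]⟩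
      rw [hfun, intervalIntegral.integral_of_le (by linarith),
        MeasureTheory.setIntegral_indicator measurableSet_Icc, hsub,
        MeasureTheory.integral_Icc_eq_integral_Ioc,
        ← intervalIntegral.integral_of_le (ha0.trans hb0).le, intervalIntegral.integral_const_mul]
    rw [hintegral] at hmain
    calc _ ≤ 8 * (η / 8) := by simpa using hmain
      _ = η := by ring
  have hzero := norm_le_zero_iff.1 (le_of_forall_pos_le_add fun η hη => by
    simpa using hclose η hη)
  rw [← mul_sub] at hzero
  have hpi : (Real.pi : ℂ) ≠ 0 := ofReal_ne_zero.2 Real.pi_ne_zero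
  linear_combination (mul_eq_zero.1 hzero).resolve_left hpi
end

section
/- Let k ≥ 1 be odd and let d_k(t) = (1/π)·lim_{y→0⁺} Im g_k(t + iy) for t ∈ I_k ∖ {0}. Then d_k(Γ(x_k) + s) = O(s^{1/2}) and d_k(Γ(x_{k+1}) − s) = O(s^{1/2}) as s → 0⁺; that is, there exist constants C > 0 and s₀ > 0 such that d_k(Γ(x_k)+s) ≤ C·√s and d_k(Γ(x_{k+1})−s) ≤ C·√s for all 0 < s < s₀. -/
open Complex Filter

open Topology in
theorem exists_strictDeriv_sq_eq {f : ℂ → ℂ} {x : ℝ} (hf : AnalyticAt ℂ f x)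
    (hreal : ∀ u : ℝ, (f u).im = 0) (hderiv : deriv f x = 0) {c : ℝ} (hc : 0 < c)
    (hgrow : ∀ᶠ h : ℝ in 𝓝[>] 0, c * h ^ 2 ≤ ‖f (x + h * I) - f x‖) :
    ∃ (σ b : ℝ) (φ : ℂ → ℂ), σ ^ 2 = 1 ∧ 0 < b ∧ HasStrictDerivAt φ b x ∧ φ x = 0 ∧
      (∀ w, φ w ^ 2 = σ * (f w - f x)) ∧ ∀ᶠ w in 𝓝 (x : ℂ), w.im = 0 → (φ w).im = 0 := by
  set q : ℂ → ℂ := dslope (dslope f x) x with hq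
  have hqa : AnalyticAt ℂ q x := by
    obtain ⟨p, hp⟩ := hf
    exact ⟨_, hp.has_fpower_series_dslope_fslope.has_fpower_series_dslope_fslope⟩
  have hfq : ∀ w, f w - f x = (w - x) ^ 2 * q w := by
    intro w
    have h1 := sub_smul_dslope f (x : ℂ) w
    have h2 := sub_smul_dslope (dslope f x) (x : ℂ) w
    rw [dslope_same, hderiv, sub_zero] at h2
    rw [← h1, ← h2, smul_eq_mul, smul_eq_mul, pow_two, mul_assoc]
  have hqim_ne : ∀ u : ℝ, u ≠ x → (q u).im = 0 := by
    intro u hu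
    have hux : ((u : ℂ) - x) ≠ 0 := sub_ne_zero.2 (by exact_mod_cast hu)
    have h1 : q u = (((f u).re - (f x).re) / (u - x) ^ 2 : ℝ) := by
      have e1 : f u = ((f u).re : ℂ) := Complex.ext rfl (by simp [hreal])
      have e2 : f x = ((f x).re : ℂ) := Complex.ext rfl (by simp [hreal])
      push_cast
      rw [← e1, ← e2, hfq u]
      field_simp
    rw [h1, ofReal_im]
  have hqim : ∀ u : ℝ, (q u).im = 0 := by
    intro u
    by_cases hu : u = x
    · subst hu
      have hcont : Tendsto (fun v : ℝ => (q v).im) (𝓝[≠] u) (𝓝 (q u).im) := by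
        have : ContinuousAt (fun v : ℝ => (q v).im) u :=
          continuous_im.continuousAt.comp
            (ContinuousAt.comp (f := fun v : ℝ => (v : ℂ)) hqa.continuousAt
              continuous_ofReal.continuousAt)
        exact this.tendsto.mono_left nhdsWithin_le_nhds
      refine tendsto_nhds_unique hcont (Tendsto.congr' ?_ tendsto_const_nhds)
      filter_upwards [self_mem_nhdsWithin] with v hv using (hqim_ne v hv).symm
    · exact hqim_ne u hu
  have hqne : q x ≠ 0 := by
    have hlim : Tendsto (fun h : ℝ => ‖q (x + h * I)‖) (𝓝[>] 0) (𝓝 ‖q x‖) := by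
      have h0 : Tendsto (fun h : ℝ => (x : ℂ) + h * I) (𝓝 0) (𝓝 x) := by
        have : Continuous (fun h : ℝ => (x : ℂ) + h * I) := by fun_prop
        simpa using this.tendsto 0
      exact ((hqa.continuousAt.tendsto.comp h0).norm).mono_left nhdsWithin_le_nhds
    have : c ≤ ‖q x‖ := by
      refine ge_of_tendsto hlim ?_
      filter_upwards [hgrow, self_mem_nhdsWithin] with h hh hpos
      have hpos : 0 < h := hpos
      rw [hfq] at hh
      simp only [add_sub_cancel_left, norm_mul, norm_pow, norm_real, norm_I, mul_one,
        Real.norm_eq_abs, sq_abs] at hh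
      exact le_of_mul_le_mul_left (by linarith) (pow_pos hpos 2)
    intro h0
    rw [h0, norm_zero] at this
    linarith
  have hare : (q x).re ≠ 0 := fun h => hqne (Complex.ext h (hqim x))
  obtain ⟨σ, hσ, hσpos⟩ : ∃ σ : ℝ, σ ^ 2 = 1 ∧ 0 < σ * (q x).re := by
    rcases lt_or_gt_of_ne hare with h | h
    · exact ⟨-1, by norm_num, by linarith⟩
    · exact ⟨1, by norm_num, by linarith⟩
  set p : ℂ → ℂ := fun w => σ * q w with hp
  have hpa : AnalyticAt ℂ p x := analyticAt_const.mul hqa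
  have hpreal : ∀ u : ℝ, p u = ((σ * (q u).re : ℝ) : ℂ) := fun u => by
    apply Complex.ext <;> simp [hp, hqim u]
  have hslit : p x ∈ slitPlane := by
    rw [hpreal]
    exact ofReal_mem_slitPlane.2 hσpos
  have hra : AnalyticAt ℂ (fun w => p w ^ (((2 : ℕ) : ℂ)⁻¹)) x :=
    hpa.cpow analyticAt_const hslit
  have hrreal : ∀ u : ℝ, 0 ≤ σ * (q u).re →
      p u ^ (((2 : ℕ) : ℂ)⁻¹) = (((σ * (q u).re) ^ (((2 : ℕ) : ℝ)⁻¹) : ℝ) : ℂ) := by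
    intro u hu
    rw [hpreal, ofReal_cpow hu]
    simp
  have hφa : AnalyticAt ℂ (fun w => (w - x) * p w ^ (((2 : ℕ) : ℂ)⁻¹)) x :=
    (analyticAt_id.sub analyticAt_const).mul hra
  refine ⟨σ, (σ * (q x).re) ^ (((2 : ℕ) : ℝ)⁻¹),
    fun w => (w - x) * p w ^ (((2 : ℕ) : ℂ)⁻¹), hσ, Real.rpow_pos_of_pos hσpos _, ?_, by simp,
    ?_, ?_⟩
  · have h1 := hφa.hasStrictDerivAt
    have h2 := ((hasDerivAt_id (x : ℂ)).sub_const (x : ℂ)).mul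
      hra.differentiableAt.hasDerivAt
    have h3 := h2.deriv
    simp only [id, sub_self, zero_mul, add_zero, one_mul] at h3
    rw [← hrreal x hσpos.le, ← h3]
    exact h1
  · intro w
    rw [mul_pow, cpow_nat_inv_pow _ two_ne_zero, hfq]
    ring
  · have hev : ∀ᶠ w in 𝓝 (x : ℂ), 0 < (p w).re := by
      have : ContinuousAt (fun w => (p w).re) x :=
        continuous_re.continuousAt.comp hpa.continuousAt
      refine this.eventually (lt_mem_nhds ?_)
      simpa only [hpreal, ofReal_re] using hσpos
    filter_upwards [hev] with w hw hwim
    have hwr : w = (w.re : ℂ) := Complex.ext rfl (by simp [hwim])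
    rw [hwr] at hw ⊢
    have hw' : 0 ≤ σ * (q (w.re : ℂ)).re := by
      rw [hpreal, ofReal_re] at hw; exact hw.le
    rw [hrreal _ hw', ← ofReal_sub, ← ofReal_mul, ofReal_im]

theorem exists_sq_eq_of_im_ne_zero {v : ℂ} (hv : v.im ≠ 0) : ∃ η : ℂ, η ^ 2 = v ∧ 0 < η.im := by
  set ρ := v ^ (((2 : ℕ) : ℂ)⁻¹)
  have hρ : ρ ^ 2 = v := cpow_nat_inv_pow _ two_ne_zero
  have him : ρ.im ≠ 0 := fun h => hv (by rw [← hρ, pow_two, mul_im, h]; ring)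
  rcases lt_or_gt_of_ne him with h | h
  · exact ⟨-ρ, by rw [neg_sq, hρ], by simpa using h⟩
  · exact ⟨ρ, hρ, h⟩

open Topology in
theorem exists_upper_preimage_near {f : ℂ → ℂ} {x : ℝ} (hf : AnalyticAt ℂ f x)
    (hreal : ∀ u : ℝ, (f u).im = 0) (hderiv : deriv f x = 0) {c : ℝ} (hc : 0 < c)
    (hgrow : ∀ᶠ h : ℝ in 𝓝[>] 0, c * h ^ 2 ≤ ‖f (x + h * I) - f x‖) :
    ∃ C > (0 : ℝ), ∀ U ∈ 𝓝 (x : ℂ), ∀ᶠ z in 𝓝 (f x), 0 < z.im →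
      ∃ w ∈ U, 0 < w.im ∧ f w = z ∧ ‖w - x‖ ≤ C * √‖z - f x‖ := by
  obtain ⟨σ, b, φ, hσ, hb, hφ, hφx, hφsq, hφreal⟩ :=
    exists_strictDeriv_sq_eq hf hreal hderiv hc hgrow
  refine ⟨2 / b, by positivity, fun U hU => ?_⟩
  have hb0 : (b : ℂ) ≠ 0 := by exact_mod_cast hb.ne'
  have happrox : ∀ᶠ q : ℂ × ℂ in 𝓝 ((x : ℂ), (x : ℂ)),
      ‖φ q.1 - φ q.2 - (q.1 - q.2) * b‖ ≤ b / 2 * ‖q.1 - q.2‖ := by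
    have := (hasStrictDerivAt_iff_hasStrictFDerivAt.1 hφ).isLittleO.def (half_pos hb)
    simpa using this
  have h1 : ∀ᶠ w in 𝓝 (x : ℂ), ‖φ w - φ x - (w - x) * b‖ ≤ b / 2 * ‖w - x‖ :=
    (show Tendsto (fun w : ℂ => (w, (x : ℂ))) (𝓝 (x : ℂ)) (𝓝 ((x : ℂ), (x : ℂ))) from
      Continuous.tendsto (by fun_prop) _).eventually happrox
  have hre : Tendsto (fun w : ℂ => ((w.re : ℝ) : ℂ)) (𝓝 (x : ℂ)) (𝓝 (x : ℂ)) := by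
    have : Continuous (fun w : ℂ => ((w.re : ℝ) : ℂ)) := by fun_prop
    simpa using this.tendsto (x : ℂ)
  have h2 : ∀ᶠ w in 𝓝 (x : ℂ),
      ‖φ w - φ w.re - (w - w.re) * b‖ ≤ b / 2 * ‖w - w.re‖ :=
    (tendsto_id.prodMk_nhds hre).eventually happrox
  have h3 : ∀ᶠ w in 𝓝 (x : ℂ), (φ w.re).im = 0 := by
    filter_upwards [hre.eventually hφreal] with w hw using hw (by simp)
  have himage : ∀ᶠ η in 𝓝 (0 : ℂ), ∃ w, φ w = η ∧ w ∈ U ∧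
      ‖φ w - φ x - (w - x) * b‖ ≤ b / 2 * ‖w - x‖ ∧
      ‖φ w - φ w.re - (w - w.re) * b‖ ≤ b / 2 * ‖w - w.re‖ ∧ (φ w.re).im = 0 := by
    rw [← hφx, ← hφ.map_nhds_eq hb0, eventually_map]
    filter_upwards [hU, h1, h2, h3] with w hwU hw1 hw2 hw3 using ⟨w, rfl, hwU, hw1, hw2, hw3⟩
  obtain ⟨ε, hε, hball⟩ := Metric.eventually_nhds_iff.1 himage
  rw [Metric.eventually_nhds_iff]
  refine ⟨ε ^ 2, by positivity, fun z hz hzim => ?_⟩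
  have hσ0 : σ ≠ 0 := by rintro rfl; norm_num at hσ
  have hσabs : |σ| = 1 := by
    rw [← sq_eq_sq₀ (abs_nonneg _) zero_le_one, sq_abs, hσ, one_pow]
  obtain ⟨η, hη, hηim⟩ : ∃ η : ℂ, η ^ 2 = σ * (z - f x) ∧ 0 < η.im := by
    apply exists_sq_eq_of_im_ne_zero
    simp [hreal, hσ0, hzim.ne']
  have hηnorm : ‖η‖ ^ 2 = ‖z - f x‖ := by
    rw [← norm_pow, hη, norm_mul, norm_real, Real.norm_eq_abs, hσabs, one_mul]
  have hηlt : dist η 0 < ε := by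
    rw [dist_zero_right]
    rw [dist_eq_norm, ← hηnorm] at hz
    exact lt_of_pow_lt_pow_left₀ 2 hε.le hz
  obtain ⟨w, hwη, hwU, hw1, hw2, hw3⟩ := hball hηlt
  refine ⟨w, hwU, ?_, ?_, ?_⟩
  · by_contra hneg
    push Not at hneg
    have e : w - (w.re : ℂ) = (w.im : ℂ) * I := by
      apply Complex.ext <;> simp
    have him := (abs_im_le_norm _).trans hw2
    rw [e] at him
    simp only [sub_im, hwη, hw3, norm_mul, norm_real, norm_I, mul_one, Real.norm_eq_abs,
      abs_of_nonpos hneg] at him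
    simp at him
    have := (abs_le.1 him).2
    nlinarith
  · have h := hφsq w
    rw [hwη, hη] at h
    have := mul_left_cancel₀ (by exact_mod_cast hσ0 : (σ : ℂ) ≠ 0) h
    exact (sub_left_injective this).symm
  · rw [← hηnorm, Real.sqrt_sq (norm_nonneg _)]
    rw [hφx, sub_zero, hwη] at hw1
    have h4 : ‖w - x‖ * b ≤ ‖η‖ + b / 2 * ‖w - x‖ := by
      calc ‖w - x‖ * b = ‖(w - x) * b‖ := by simp [abs_of_pos hb]
        _ = ‖η - (η - (w - x) * b)‖ := by ring_nf
        _ ≤ ‖η‖ + ‖η - (w - x) * b‖ := norm_sub_le _ _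
        _ ≤ _ := by gcongr
    rw [div_mul_eq_mul_div, le_div_iff₀ hb]
    linarith

theorem norm_Gamma_add_mul_I_le {u : ℝ} (hu : ∀ m : ℕ, u ≠ -m) (h : ℝ) :
    ‖Gamma (u + h * I)‖ ≤ ‖Gamma u‖ := by
  refine le_of_tendsto_of_tendsto (GammaSeq_tendsto_Gamma _).norm (GammaSeq_tendsto_Gamma _).norm ?_
  filter_upwards [eventually_gt_atTop 0] with n hn
  have hn' : (0 : ℝ) < n := by exact_mod_cast hn
  have hcpow : ∀ s : ℂ, ‖(n : ℂ) ^ s‖ = (n : ℝ) ^ s.re := fun s => by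
    rw [← ofReal_natCast, norm_cpow_eq_rpow_re_of_pos hn']
  simp only [GammaSeq, norm_div, norm_mul, hcpow, norm_prod]
  simp only [add_re, ofReal_re, mul_re, I_re, mul_zero, ofReal_im, I_im, mul_one, sub_self,
    add_zero]
  have hle : ∀ j : ℕ, ‖(u : ℂ) + j‖ ≤ ‖(u : ℂ) + h * I + j‖ := fun j => by
    have := abs_re_le_norm ((u : ℂ) + h * I + j)
    simp only [add_re, ofReal_re, mul_re, I_re, mul_zero, ofReal_im, I_im, mul_one, sub_self,
      add_zero, natCast_re] at this
    rwa [← ofReal_natCast, ← ofReal_add, norm_real]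
  gcongr with j hj
  · refine Finset.prod_pos fun j _ => norm_pos_iff.2 ?_
    intro h0
    refine hu j ?_
    have : (u : ℂ) = -j := eq_neg_of_add_eq_zero_left h0
    exact_mod_cast this
  · exact hle j

open Topology in
theorem eventually_le_norm_Gamma_sub {x : ℝ} (hx : ∀ m : ℕ, x ≠ -m) :
    ∃ c > (0 : ℝ), ∀ᶠ h : ℝ in 𝓝[>] 0, c * h ^ 2 ≤ ‖Gamma (x + h * I) - Gamma x‖ := by
  have hx0 : x ≠ 0 := by simpa using hx 0
  have hx1 : ∀ m : ℕ, x + 1 ≠ -m := fun m hm => hx (m + 1) (by push_cast; linarith)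
  have ht : 0 < ‖Gamma x‖ :=
    norm_pos_iff.2 (Gamma_ne_zero fun m hm => hx m (by exact_mod_cast hm))
  refine ⟨‖Gamma x‖ / (2 * (x ^ 2 + 1)), by positivity, ?_⟩
  filter_upwards [Ioo_mem_nhdsGT (zero_lt_one (α := ℝ))] with h hh
  have hne : (x : ℂ) + h * I ≠ 0 := fun h0 => hx0 (by simpa using congrArg re h0)
  have hbound : ‖(x : ℂ) + h * I‖ * ‖Gamma (x + h * I)‖ ≤ |x| * ‖Gamma x‖ := by
    have := norm_Gamma_add_mul_I_le hx1 h
    rw [show ((x + 1 : ℝ) : ℂ) + h * I = (x + h * I) + 1 by push_cast; ring, Gamma_add_one _ hne,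
      ofReal_add, ofReal_one, Gamma_add_one _ (by exact_mod_cast hx0), norm_mul, norm_mul,
      norm_real, Real.norm_eq_abs] at this
    exact this
  have hN : ‖(x : ℂ) + h * I‖ ^ 2 = |x| ^ 2 + h ^ 2 := by
    rw [← normSq_eq_norm_sq, normSq_add_mul_I, sq_abs]
  have htri : ‖Gamma x‖ - ‖Gamma (x + h * I)‖ ≤ ‖Gamma (x + h * I) - Gamma x‖ := by
    rw [norm_sub_rev]; exact norm_sub_norm_le _ _
  refine le_trans ?_ htri
  have hNpos : 0 < ‖(x : ℂ) + h * I‖ := norm_pos_iff.2 hne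
  have hxN : |x| ≤ ‖(x : ℂ) + h * I‖ := by
    rw [← sq_le_sq₀ (abs_nonneg _) hNpos.le, hN]; nlinarith [sq_nonneg h]
  have hN1 : ‖(x : ℂ) + h * I‖ ^ 2 ≤ x ^ 2 + 1 := by
    rw [hN, sq_abs]; nlinarith [hh.1, hh.2]
  generalize ‖(x : ℂ) + h * I‖ = N at *
  generalize ‖Gamma (x + h * I)‖ = G at *
  generalize ‖Gamma (x : ℂ)‖ = T at *
  have hG : G ≤ |x| * T / N := by rw [le_div_iff₀ hNpos]; linarith
  have h1 : T * h ^ 2 / (2 * N ^ 2) ≤ T - |x| * T / N := by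
    rw [div_le_iff₀ (by positivity)]
    have : (T - |x| * T / N) * (2 * N ^ 2) = 2 * T * N * (N - |x|) := by field_simp
    rw [this]
    nlinarith [mul_nonneg ht.le (sq_nonneg (N - |x|))]
  have h2 : T / (2 * (x ^ 2 + 1)) * h ^ 2 ≤ T * h ^ 2 / (2 * N ^ 2) := by
    rw [div_mul_eq_mul_div]
    gcongr
  linarith

/-- The general term of the series defining `logGamma`. -/
noncomputable def logGammaTerm (k : ℕ) (z : ℂ) : ℂ := log (1 + z / (k + 1)) - z / (k + 1)

theorem norm_logGammaTerm_le {R : ℝ} {k : ℕ} {z : ℂ} (hz : ‖z‖ ≤ R) (hk : 2 * R ≤ k + 1) :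
    ‖logGammaTerm k z‖ ≤ R ^ 2 * (1 / ((k : ℝ) + 1) ^ 2) := by
  have hk0 : (0 : ℝ) < k + 1 := by positivity
  have hnorm : ‖z / ((k : ℂ) + 1)‖ = ‖z‖ / (k + 1) := by
    rw [norm_div]; congr 1
    exact_mod_cast norm_natCast (k + 1)
  have hhalf : ‖z / ((k : ℂ) + 1)‖ ≤ 1 / 2 := by
    rw [hnorm, div_le_iff₀ hk0]; linarith
  refine (norm_log_one_add_sub_self_le (by linarith)).trans ?_
  have hinv : (1 - ‖z / ((k : ℂ) + 1)‖)⁻¹ ≤ 2 := by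
    rw [inv_le_comm₀ (by linarith) two_pos]; linarith
  calc ‖z / ((k : ℂ) + 1)‖ ^ 2 * (1 - ‖z / ((k : ℂ) + 1)‖)⁻¹ / 2
      ≤ ‖z / ((k : ℂ) + 1)‖ ^ 2 * 2 / 2 := by gcongr
    _ = ‖z‖ ^ 2 * (1 / ((k : ℝ) + 1) ^ 2) := by rw [hnorm]; field_simp
    _ ≤ _ := by gcongr

theorem summable_one_div_add_one_sq : Summable fun k : ℕ => 1 / ((k : ℝ) + 1) ^ 2 := by
  have := (summable_nat_add_iff 1).2 (Real.summable_one_div_nat_pow.2 one_lt_two)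
  simpa using this

theorem summable_logGammaTerm (z : ℂ) : Summable fun k => logGammaTerm k z := by
  refine Summable.of_norm_bounded_eventually_nat
    (summable_one_div_add_one_sq.mul_left (‖z‖ ^ 2)) ?_
  filter_upwards [eventually_ge_atTop ⌈2 * ‖z‖⌉₊] with k hk
  exact norm_logGammaTerm_le le_rfl (by have := Nat.ceil_le.1 hk; linarith)

theorem logGamma_eq (z : ℂ) : logGamma z =
    -(Real.eulerMascheroniConstant : ℂ) * z - log z - ∑' k, logGammaTerm k z := rfl

open Topology in
theorem exp_logGamma_s10 {z : ℂ} (hz : ∀ m : ℕ, z ≠ -m) : exp (logGamma z) = Gamma z := by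
  have hz0 : z ≠ 0 := by simpa using hz 0
  have hzk : ∀ k : ℕ, 1 + z / ((k : ℂ) + 1) ≠ 0 := fun k h0 => by
    have hk : ((k : ℂ) + 1) ≠ 0 := by exact_mod_cast k.succ_ne_zero
    refine hz (k + 1) ?_
    field_simp at h0
    push_cast
    linear_combination h0
  have hsum := (summable_logGammaTerm z).hasSum.tendsto_sum_nat
  have hL : Tendsto (fun n => exp (-(Real.eulerMascheroniConstant : ℂ) * z - log z -
      ∑ k ∈ Finset.range n, logGammaTerm k z)) atTop (𝓝 (exp (logGamma z))) :=
    (continuous_exp.tendsto _).comp (tendsto_const_nhds.sub hsum)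
  have hγ : Tendsto (fun n : ℕ => exp (z * (Real.eulerMascheroniConstant -
      ((harmonic n - Real.log n : ℝ) : ℂ)))) atTop (𝓝 1) := by
    have h1 : Tendsto (fun n : ℕ => ((harmonic n - Real.log n : ℝ) : ℂ)) atTop
        (𝓝 (Real.eulerMascheroniConstant : ℂ)) :=
      (continuous_ofReal.tendsto _).comp Real.tendsto_harmonic_sub_log
    have h2 := (continuous_exp.tendsto _).comp ((tendsto_const_nhds (x := z)).mul
      ((tendsto_const_nhds (x := (Real.eulerMascheroniConstant : ℂ))).sub h1))
    simpa [Function.comp_def] using h2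
  have hprod := hL.mul hγ
  rw [mul_one] at hprod
  refine tendsto_nhds_unique hprod ((GammaSeq_tendsto_Gamma z).congr' ?_)
  filter_upwards [eventually_gt_atTop 0] with n hn
  have hn0 : (n : ℂ) ≠ 0 := by exact_mod_cast hn.ne'
  have hexp : -(Real.eulerMascheroniConstant : ℂ) * z - log z -
      ∑ k ∈ Finset.range n, logGammaTerm k z + z * (Real.eulerMascheroniConstant -
        ((harmonic n - Real.log n : ℝ) : ℂ)) =
      log n * z - log z - ∑ k ∈ Finset.range n, log (1 + z / (k + 1)) := by
    have hh : ((harmonic n : ℝ) : ℂ) * z = ∑ k ∈ Finset.range n, z / ((k : ℂ) + 1) := by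
      rw [harmonic]
      push_cast
      rw [Finset.sum_mul]
      exact Finset.sum_congr rfl fun k _ => by rw [div_eq_mul_inv, mul_comm]
    simp only [logGammaTerm, Finset.sum_sub_distrib, ← hh]
    push_cast
    ring
  rw [← exp_add, hexp, exp_sub, exp_sub, exp_sum, exp_log hz0, GammaSeq,
    cpow_def_of_ne_zero hn0, Finset.prod_range_succ']
  have hP : ∏ k ∈ Finset.range n, (z + ((k + 1 : ℕ) : ℂ)) =
      (n.factorial : ℂ) * ∏ k ∈ Finset.range n, exp (log (1 + z / (k + 1))) := by
    rw [← Finset.prod_range_add_one_eq_factorial, Nat.cast_prod, ← Finset.prod_mul_distrib]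
    refine Finset.prod_congr rfl fun k _ => ?_
    have hk : ((k : ℂ) + 1) ≠ 0 := by exact_mod_cast k.succ_ne_zero
    rw [exp_log (hzk k)]
    push_cast
    field_simp
    ring
  have hfac : (n.factorial : ℂ) ≠ 0 := by exact_mod_cast n.factorial_ne_zero
  have hprodne : ∏ k ∈ Finset.range n, exp (log (1 + z / ((k : ℂ) + 1))) ≠ 0 :=
    Finset.prod_ne_zero_iff.2 fun k _ => exp_ne_zero _
  rw [hP]
  simp only [Nat.cast_zero, add_zero]
  field_simp

theorem im_log_sub_div_neg {a b : ℂ} (ha : 0 < a.im) (hb : 0 < b.im) (hab : a ≠ b) :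
    ((log a - log b) / (a - b)).im < 0 := by
  have hsub : a - b ≠ 0 := sub_ne_zero.2 hab
  have him : ∀ t ∈ Set.Icc (0 : ℝ) 1, 0 < (b + t * (a - b)).im := by
    intro t ht
    simp
    nlinarith [ht.1, ht.2, mul_nonneg ht.1 ha.le, mul_nonneg (sub_nonneg.2 ht.2) hb.le]
  have hder : ∀ t ∈ Set.Icc (0 : ℝ) 1, HasDerivAt
      (fun t : ℝ => (log (b + t * (a - b)) / (a - b)).im) ((b + t * (a - b))⁻¹.im) t := by
    intro t ht
    have h1 : HasDerivAt (fun s : ℂ => log (b + s * (a - b)) / (a - b))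
        ((b + t * (a - b))⁻¹) (t : ℂ) := by
      have h2 : HasDerivAt (fun s : ℂ => b + s * (a - b)) (a - b) (t : ℂ) := by
        simpa using ((hasDerivAt_id (t : ℂ)).mul_const (a - b)).const_add b
      have h3 := (h2.clog (mem_slitPlane_iff.2 (Or.inr (him t ht).ne'))).div_const (a - b)
      rwa [div_right_comm, div_self hsub, one_div] at h3
    have := h1.comp_ofReal
    exact (imCLM.hasFDerivAt.comp_hasDerivAt t this)
  obtain ⟨c, hc, hc'⟩ := exists_hasDerivAt_eq_slope _ _ zero_lt_one
    (fun t ht => (hder t ht).continuousAt.continuousWithinAt)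
    (fun t ht => hder t (Set.Ioo_subset_Icc_self ht))
  have hlhs : ((b + c * (a - b))⁻¹).im < 0 := by
    have hpos := him c (Set.Ioo_subset_Icc_self hc)
    rw [inv_im]
    exact div_neg_of_neg_of_pos (neg_neg_of_pos hpos)
      (normSq_pos.2 fun h0 => by rw [h0] at hpos; simp at hpos)
  rw [hc'] at hlhs
  simpa [sub_div] using hlhs

theorem im_logGammaTerm_sub_div_neg {z w : ℂ} (hz : 0 < z.im) (hw : 0 < w.im) (hzw : z ≠ w)
    (k : ℕ) : ((logGammaTerm k z - logGammaTerm k w) / (z - w)).im < 0 := by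
  have hk : (0 : ℝ) < k + 1 := by positivity
  have hkC : ((k : ℂ) + 1) ≠ 0 := by exact_mod_cast k.succ_ne_zero
  have hcast : ((k : ℂ) + 1) = (((k : ℝ) + 1 : ℝ) : ℂ) := by push_cast; rfl
  have hpos : ∀ v : ℂ, 0 < v.im → 0 < (1 + v / ((k : ℂ) + 1)).im := fun v hv => by
    rw [hcast, add_im, one_im, div_ofReal_im, zero_add]; positivity
  have hne : 1 + z / ((k : ℂ) + 1) ≠ 1 + w / ((k : ℂ) + 1) := fun h => by
    apply hzw
    field_simp at h
    linear_combination h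
  have hsub : z - w ≠ 0 := sub_ne_zero.2 hzw
  have h := im_log_sub_div_neg (hpos z hz) (hpos w hw) hne
  have e : (logGammaTerm k z - logGammaTerm k w) / (z - w) =
      (log (1 + z / ((k : ℂ) + 1)) - log (1 + w / ((k : ℂ) + 1))) /
        (1 + z / ((k : ℂ) + 1) - (1 + w / ((k : ℂ) + 1))) / (((k : ℝ) + 1 : ℝ) : ℂ) -
      ((((k : ℝ) + 1)⁻¹ : ℝ) : ℂ) := by
    have e1 : 1 + z / ((k : ℂ) + 1) - (1 + w / ((k : ℂ) + 1)) = (z - w) / (k + 1) := by ring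
    rw [e1]
    simp only [logGammaTerm]
    push_cast
    field_simp
    ring
  rw [e, sub_im, div_ofReal_im, ofReal_im, sub_zero]
  exact div_neg_of_neg_of_pos h hk

theorem logGamma_injOn : Set.InjOn logGamma {z : ℂ | 0 < z.im} := by
  intro z hz w hw hL
  by_contra hzw
  have hsub : z - w ≠ 0 := sub_ne_zero.2 hzw
  have hs : HasSum (fun k => ((logGammaTerm k z - logGammaTerm k w) / (z - w)).im)
      (((∑' k, logGammaTerm k z - ∑' k, logGammaTerm k w) / (z - w)).im) :=
    imCLM.hasSum
      (((summable_logGammaTerm z).hasSum.sub (summable_logGammaTerm w).hasSum).div_const (z - w))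
  have h1 : ((∑' k, logGammaTerm k z - ∑' k, logGammaTerm k w) / (z - w)).im ≤ 0 :=
    hs.nonpos fun k => (im_logGammaTerm_sub_div_neg hz hw hzw k).le
  have h2 := im_log_sub_div_neg hz hw hzw
  rw [logGamma_eq, logGamma_eq] at hL
  have h3 : (∑' k, logGammaTerm k z - ∑' k, logGammaTerm k w) / (z - w) =
      -(Real.eulerMascheroniConstant : ℂ) - (log z - log w) / (z - w) := by
    field_simp
    linear_combination -hL
  rw [h3, sub_im, neg_im, ofReal_im] at h1
  linarith

theorem im_log_ofReal_of_neg {a : ℝ} (ha : a < 0) : (log (a : ℂ)).im = Real.pi := by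
  rw [log_im, arg_ofReal_of_neg ha]

theorem im_log_ofReal_of_nonneg {a : ℝ} (ha : 0 ≤ a) : (log (a : ℂ)).im = 0 := by
  rw [log_im, arg_ofReal_of_nonneg ha]

theorem im_logGamma_ofReal {n : ℕ} {x : ℝ} (hx : x ∈ Set.Ioo (-((n : ℝ) + 1)) (-(n : ℝ))) :
    (logGamma x).im = -(((n : ℝ) + 1) * Real.pi) := by
  have hx0 : x < 0 := hx.2.trans_le (by simp)
  have hterm : ∀ k : ℕ, logGammaTerm k x =
      log ((1 + x / (k + 1) : ℝ) : ℂ) - ((x / (k + 1) : ℝ) : ℂ) := fun k => by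
    rw [logGammaTerm]; push_cast; rfl
  have hlow : ∀ k ∈ Finset.range n, (logGammaTerm k x).im = Real.pi := by
    intro k hk
    have hkn : (k : ℝ) + 1 ≤ n := by exact_mod_cast Finset.mem_range.1 hk
    have hk0 : (0 : ℝ) < k + 1 := by positivity
    rw [hterm, sub_im, ofReal_im, sub_zero, im_log_ofReal_of_neg]
    have : x / (k + 1) < -1 := by rw [div_lt_iff₀ hk0]; linarith [hx.2]
    linarith
  have hhigh : ∀ k ∉ Finset.range n, (logGammaTerm k x).im = 0 := by
    intro k hk
    have hkn : (n : ℝ) ≤ k := by exact_mod_cast not_lt.1 fun h => hk (Finset.mem_range.2 h)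
    have hk0 : (0 : ℝ) < k + 1 := by positivity
    rw [hterm, sub_im, ofReal_im, sub_zero, im_log_ofReal_of_nonneg]
    have : -1 ≤ x / (k + 1) := by rw [le_div_iff₀ hk0]; linarith [hx.1]
    linarith
  have hsum : (∑' k, logGammaTerm k x).im = n * Real.pi := by
    have h1 : HasSum (fun k => (logGammaTerm k x).im) (∑' k, logGammaTerm k x).im :=
      imCLM.hasSum (summable_logGammaTerm x).hasSum
    have h2 : HasSum (fun k => (logGammaTerm k x).im) _ := hasSum_sum_of_ne_finset_zero hhigh
    rw [Finset.sum_congr rfl hlow] at h2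
    rw [h1.unique h2]
    simp
  rw [logGamma_eq, sub_im, sub_im, hsum, im_log_ofReal_of_neg hx0, ← ofReal_neg, ← ofReal_mul,
    ofReal_im]
  ring

theorem continuousWithinAt_log_im_nonneg {a : ℝ} (ha : a ≠ 0) :
    ContinuousWithinAt log {z : ℂ | 0 ≤ z.im} a := by
  rcases lt_or_gt_of_ne ha with h | h
  · exact continuousWithinAt_log_of_re_neg_of_im_zero (by simpa using h) (by simp)
  · exact (continuousAt_clog (ofReal_mem_slitPlane.2 h)).continuousWithinAt

theorem continuousWithinAt_logGammaTerm {x : ℝ} (hx : ∀ m : ℕ, x ≠ -m) (k : ℕ) :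
    ContinuousWithinAt (logGammaTerm k) {z : ℂ | 0 ≤ z.im} x := by
  have hk0 : (0 : ℝ) < k + 1 := by positivity
  have hne : 1 + x / (k + 1) ≠ 0 := fun h0 => by
    refine hx (k + 1) ?_
    field_simp at h0
    push_cast
    linarith
  have hcast : ((k : ℂ) + 1) = (((k : ℝ) + 1 : ℝ) : ℂ) := by push_cast; rfl
  have haff : Continuous fun z : ℂ => 1 + z / ((k : ℂ) + 1) := by fun_prop
  have hdiv : Continuous fun z : ℂ => z / ((k : ℂ) + 1) := by fun_prop
  refine ContinuousWithinAt.sub ?_ hdiv.continuousWithinAt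
  refine ContinuousWithinAt.comp (g := log) (t := {z : ℂ | 0 ≤ z.im}) ?_
    haff.continuousWithinAt ?_
  · have := continuousWithinAt_log_im_nonneg hne
    push_cast at this
    exact this
  · intro z hz
    have hz : 0 ≤ z.im := hz
    change 0 ≤ (1 + z / ((k : ℂ) + 1)).im
    rw [hcast, add_im, one_im, div_ofReal_im, zero_add]
    positivity

theorem continuousOn_logGammaTerm {R : ℝ} {k : ℕ} (hk : 2 * R ≤ k + 1) :
    ContinuousOn (logGammaTerm k) (Metric.closedBall 0 R) := by
  have hk0 : (0 : ℝ) < k + 1 := by positivity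
  have hdiv : Continuous fun z : ℂ => z / ((k : ℂ) + 1) := by fun_prop
  refine ContinuousOn.sub (ContinuousOn.clog (by fun_prop) ?_) hdiv.continuousOn
  intro z hz
  apply mem_slitPlane_of_norm_lt_one
  have hcast : ((k : ℂ) + 1) = ((k + 1 : ℕ) : ℂ) := by push_cast; rfl
  rw [hcast, norm_div, norm_natCast, Nat.cast_add_one, div_lt_one hk0]
  have := mem_closedBall_zero_iff.1 hz
  linarith

open Topology in
theorem continuousWithinAt_logGamma {x : ℝ} (hx : ∀ m : ℕ, x ≠ -m) :
    ContinuousWithinAt logGamma {z : ℂ | 0 ≤ z.im} x := by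
  have hx0 : x ≠ 0 := by simpa using hx 0
  set R : ℝ := |x| + 1 with hR
  set N : ℕ := ⌈2 * R⌉₊ with hN
  have hNR : ∀ k : ℕ, 2 * R ≤ ((k + N : ℕ) : ℝ) + 1 := fun k => by
    have := Nat.le_ceil (2 * R)
    push_cast
    have hk : (0 : ℝ) ≤ k := by positivity
    linarith
  have htail : ContinuousAt (fun z => ∑' k, logGammaTerm (k + N) z) (x : ℂ) := by
    refine ContinuousOn.continuousAt (s := Metric.closedBall 0 R) ?_ ?_
    · refine continuousOn_tsum (fun k => continuousOn_logGammaTerm (hNR k))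
        ((summable_nat_add_iff N).2 (summable_one_div_add_one_sq.mul_left (R ^ 2))) ?_
      intro k z hz
      exact norm_logGammaTerm_le (mem_closedBall_zero_iff.1 hz) (hNR k)
    · refine mem_of_superset (Metric.isOpen_ball.mem_nhds ?_) Metric.ball_subset_closedBall
      rw [mem_ball_zero_iff, norm_real, Real.norm_eq_abs]
      linarith
  have heq : logGamma = fun z => -(Real.eulerMascheroniConstant : ℂ) * z - log z -
      (∑ k ∈ Finset.range N, logGammaTerm k z + ∑' k, logGammaTerm (k + N) z) := by
    funext z
    rw [logGamma_eq, (summable_logGammaTerm z).sum_add_tsum_nat_add N]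
  rw [heq]
  refine ContinuousWithinAt.sub (ContinuousWithinAt.sub (by fun_prop)
    (continuousWithinAt_log_im_nonneg hx0)) (ContinuousWithinAt.add ?_ htail.continuousWithinAt)
  exact tendsto_finsetSum _ fun k _ => continuousWithinAt_logGammaTerm hx k

theorem ne_neg_natCast_of_mem_Ioo_s10 {n : ℕ} {x : ℝ}
    (hx : x ∈ Set.Ioo (-((n : ℝ) + 1)) (-(n : ℝ))) (m : ℕ) : x ≠ -m := by
  rintro rfl
  have h1 : (n : ℝ) < m := by linarith [hx.2]
  have h2 : (m : ℝ) < n + 1 := by linarith [hx.1]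
  norm_cast at h1 h2
  omega

theorem exp_re_logGamma_ofReal {n : ℕ} {x : ℝ}
    (hx : x ∈ Set.Ioo (-((n : ℝ) + 1)) (-(n : ℝ))) :
    Real.Gamma x = (-1) ^ (n + 1) * Real.exp (logGamma x).re := by
  have h := exp_logGamma_s10 (z := x) fun m hm =>
    ne_neg_natCast_of_mem_Ioo_s10 hx m (by exact_mod_cast hm)
  have hL : logGamma x = ((logGamma x).re : ℂ) - ((n + 1 : ℕ) : ℂ) * (Real.pi * I) := by
    apply Complex.ext <;> simp [im_logGamma_ofReal hx]
  rw [hL, exp_sub, exp_nat_mul, exp_pi_mul_I, ← ofReal_exp, Gamma_ofReal] at h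
  have hsq : ((-1 : ℂ) ^ (n + 1)) * (-1) ^ (n + 1) = 1 := by
    rw [← mul_pow]; norm_num
  have h' : (Real.Gamma x : ℂ) = (-1) ^ (n + 1) * (Real.exp (logGamma x).re : ℝ) := by
    rw [← h, div_eq_mul_inv, inv_eq_of_mul_eq_one_left hsq, mul_comm]
  exact_mod_cast h'

open Topology in
theorem analyticAt_Gamma_ofReal {n : ℕ} {x : ℝ}
    (hx : x ∈ Set.Ioo (-((n : ℝ) + 1)) (-(n : ℝ))) : AnalyticAt ℂ Gamma x := by
  rw [analyticAt_iff_eventually_differentiableAt]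
  have : ∀ᶠ z : ℂ in 𝓝 (x : ℂ), z.re ∈ Set.Ioo (-((n : ℝ) + 1)) (-(n : ℝ)) :=
    continuous_re.continuousAt.eventually (isOpen_Ioo.mem_nhds (by simpa using hx))
  filter_upwards [this] with z hz
  exact differentiableAt_Gamma z fun m hm => ne_neg_natCast_of_mem_Ioo_s10 hz m (by simp [hm])

theorem deriv_Gamma_ofReal {x : ℝ} (hx : ∀ m : ℕ, x ≠ -m) :
    deriv Gamma (x : ℂ) = deriv Real.Gamma x := by
  have h1 : HasDerivAt (fun y : ℝ => Gamma (y : ℂ)) (deriv Gamma (x : ℂ)) x :=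
    (differentiableAt_Gamma (x : ℂ)
      fun m hm => hx m (by exact_mod_cast hm)).hasDerivAt.comp_ofReal
  have h2 := (Real.differentiableAt_Gamma hx).hasDerivAt.ofReal_comp
  simp only [Gamma_ofReal] at h1
  exact h1.unique h2

open Topology in
theorem eventually_norm_sub_le_of_logGamma_eq {n k : ℕ} {x : ℝ}
    (hx : x ∈ Set.Ioo (-((n : ℝ) + 1)) (-(n : ℝ))) (hderiv : deriv Real.Gamma x = 0)
    (hkodd : Odd k) (hnk : n + 1 = k ∨ n = k) {g : ℂ → ℂ}
    (hgim : ∀ z : ℂ, 0 < z.im → 0 < (g z).im)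
    (hgL : ∀ z : ℂ, 0 < z.im → logGamma (g z) = log z - ((k : ℂ) + 1) * Real.pi * I) :
    ∃ C > (0 : ℝ), ∀ᶠ z in 𝓝 (Real.Gamma x : ℂ), 0 < z.im →
      ‖g z - x‖ ≤ C * √‖z - Real.Gamma x‖ := by
  have hpole := ne_neg_natCast_of_mem_Ioo_s10 hx
  obtain ⟨c, hc, hgrow⟩ := eventually_le_norm_Gamma_sub hpole
  obtain ⟨C, hC, hpre⟩ := exists_upper_preimage_near (analyticAt_Gamma_ofReal hx)
    (fun u => by rw [Gamma_ofReal, ofReal_im])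
    (by rw [deriv_Gamma_ofReal hpole, hderiv, ofReal_zero]) hc hgrow
  refine ⟨C, hC, ?_⟩
  have hU : {w : ℂ | 0 ≤ w.im → |(logGamma w).im + ((n : ℝ) + 1) * Real.pi| < 1} ∈ 𝓝 (x : ℂ) := by
    have hcont : Tendsto (fun w => |(logGamma w).im + ((n : ℝ) + 1) * Real.pi|)
        (𝓝[{z : ℂ | 0 ≤ z.im}] (x : ℂ)) (𝓝 0) := by
      have h1 := (((continuous_im.tendsto _).comp (continuousWithinAt_logGamma hpole)).add_const
        (((n : ℝ) + 1) * Real.pi)).abs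
      simpa [Function.comp_def, im_logGamma_ofReal hx] using h1
    exact eventually_nhdsWithin_iff.1 (hcont.eventually (gt_mem_nhds one_pos))
  have hev := hpre _ hU
  rw [Gamma_ofReal] at hev
  filter_upwards [hev] with z hz hzim
  obtain ⟨w, hwU, hwim, hwz, hwle⟩ := hz hzim
  suffices hgw : g z = w by rwa [hgw]
  refine logGamma_injOn (hgim z hzim) hwim ?_
  rw [hgL z hzim]
  have hz0 : z ≠ 0 := by rintro rfl; simp at hzim
  have hexp : exp (logGamma w) = exp (log z - ((k : ℂ) + 1) * Real.pi * I) := by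
    rw [exp_logGamma_s10 fun m hm => by rw [hm] at hwim; simp at hwim, hwz, exp_sub, exp_log hz0,
      show ((k : ℂ) + 1) * Real.pi * I = ((k + 1 : ℕ) : ℂ) * (Real.pi * I) by push_cast; ring,
      exp_nat_mul, exp_pi_mul_I, hkodd.add_one.neg_one_pow, div_one]
  obtain ⟨m, hm⟩ := exp_eq_exp_iff_exists_int.1 hexp
  have him := congrArg im hm
  have hwb := abs_lt.1 (hwU hwim.le)
  have harg1 : 0 ≤ arg z := arg_nonneg_iff.2 hzim.le
  have harg2 := arg_le_pi z
  simp [log_im] at him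
  rw [him] at hwb
  have hpi := Real.pi_gt_three
  have hnk' : (n : ℝ) + 1 = k ∨ (n : ℝ) + 1 = k + 1 :=
    hnk.imp (fun h => by exact_mod_cast h) (fun h => by rw [h])
  have hm0 : m = 0 := by
    have hlt : (m : ℝ) < 1 := by
      by_contra hge
      push Not at hge
      rcases hnk' with h | h <;> rw [h] at hwb <;> nlinarith [hwb.2]
    have hgt : (-1 : ℝ) < m := by
      by_contra hge
      push Not at hge
      rcases hnk' with h | h <;> rw [h] at hwb <;> nlinarith [hwb.1]
    norm_cast at hlt hgt
    omega
  rw [hm, hm0]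
  simp

open Topology in
theorem eventually_le_mul_sqrt_of_tendsto_im {g : ℂ → ℂ} {a C e : ℝ} {x : ℝ}
    (he : |e| = 1) (hg : ∀ᶠ z in 𝓝 (a : ℂ), 0 < z.im → ‖g z - x‖ ≤ C * √‖z - a‖) :
    ∀ᶠ s : ℝ in 𝓝[>] 0, ∀ δ : ℝ, Tendsto
      (fun y : ℝ => (1 / Real.pi) * (g (((a + e * s : ℝ) : ℂ) + y * I)).im) (𝓝[>] 0) (𝓝 δ) →
      δ ≤ C * √s := by
  have hpath : Tendsto (fun s : ℝ => ((a + e * s : ℝ) : ℂ)) (𝓝[>] 0) (𝓝 (a : ℂ)) := by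
    have : Continuous fun s : ℝ => ((a + e * s : ℝ) : ℂ) := by fun_prop
    simpa using (this.tendsto 0).mono_left nhdsWithin_le_nhds
  filter_upwards [hpath.eventually hg.eventually_nhds, self_mem_nhdsWithin] with s hs hs0 δ hδ
  have hs0 : 0 < s := hs0
  have hcont : Continuous fun y : ℝ => ((a + e * s : ℝ) : ℂ) + y * I := by fun_prop
  have hy : Tendsto (fun y : ℝ => ((a + e * s : ℝ) : ℂ) + y * I) (𝓝[>] 0)
      (𝓝 ((a + e * s : ℝ) : ℂ)) := by
    simpa using (hcont.tendsto 0).mono_left nhdsWithin_le_nhds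
  have hbound : Tendsto (fun y : ℝ => C * √‖((a + e * s : ℝ) : ℂ) + y * I - a‖) (𝓝[>] 0)
      (𝓝 (C * √s)) := by
    have h1 := ((Real.continuous_sqrt.tendsto _).comp (hy.sub_const (a : ℂ)).norm).const_mul C
    have h2 : ‖((a + e * s : ℝ) : ℂ) - a‖ = s := by
      rw [← ofReal_sub, norm_real, Real.norm_eq_abs, add_sub_cancel_left, abs_mul, he, one_mul,
        abs_of_pos hs0]
    rwa [h2] at h1
  refine le_of_tendsto_of_tendsto hδ hbound ?_
  filter_upwards [hy.eventually hs, self_mem_nhdsWithin] with y hy hy0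
  have hy0 : 0 < y := hy0
  refine le_trans ?_ (hy (by simpa using hy0))
  have him : (g (((a + e * s : ℝ) : ℂ) + y * I)).im ≤
      ‖g (((a + e * s : ℝ) : ℂ) + y * I) - x‖ := by
    simpa using im_le_norm (g (((a + e * s : ℝ) : ℂ) + y * I) - x)
  have hpi : 1 / Real.pi ≤ 1 := by
    rw [div_le_one Real.pi_pos]; linarith [Real.pi_gt_three]
  have hpi0 : 0 ≤ 1 / Real.pi := by positivity
  calc _ ≤ 1 / Real.pi * ‖g (((a + e * s : ℝ) : ℂ) + y * I) - x‖ := by gcongr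
    _ ≤ 1 * ‖g (((a + e * s : ℝ) : ℂ) + y * I) - x‖ := by gcongr
    _ = _ := one_mul _

/-- Let `k ≥ 1` be odd and `d_k(t) = (1/π)·lim_{y→0⁺} Im g_k(t+iy)` on
`I_k ∖ {0}`.  Then `d_k(Γ(x_k)+s)` and `d_k(Γ(x_{k+1})−s)` are `O(√s)` as `s → 0⁺`: there
are `C > 0` and `s₀ > 0` with `d_k(Γ(x_k)+s) ≤ C√s` and `d_k(Γ(x_{k+1})−s) ≤ C√s` for
`0 < s < s₀`. -/
theorem dk_endpoint_estimate_odd (x : ℕ → ℝ)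
    (hxk : ∀ j : ℕ, 1 ≤ j → x j ∈ Set.Ioo (-(j : ℝ)) (-(j : ℝ) + 1) ∧
      deriv Real.Gamma (x j) = 0)
    (k : ℕ) (hk1 : 1 ≤ k) (hkodd : Odd k) (g : ℂ → ℂ)
    (hg : DifferentiableOn ℂ g {z : ℂ | 0 < z.im})
    (hgim : ∀ z : ℂ, 0 < z.im → 0 < (g z).im)
    (hgL : ∀ z : ℂ, 0 < z.im →
      logGamma (g z) = Complex.log z - ((k : ℂ) + 1) * Real.pi * I)
    (d : ℝ → ℝ)
    (hd : ∀ t ∈ Set.Icc (Real.Gamma (x k)) (Real.Gamma (x (k + 1))) \ {0},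
      Tendsto (fun y : ℝ => (1 / Real.pi) * (g ((t : ℂ) + y * I)).im)
        (nhdsWithin 0 (Set.Ioi 0)) (nhds (d t))) :
    ∃ C > (0 : ℝ), ∃ s₀ > (0 : ℝ), ∀ s : ℝ, 0 < s → s < s₀ →
      d (Real.Gamma (x k) + s) ≤ C * Real.sqrt s ∧
      d (Real.Gamma (x (k + 1)) - s) ≤ C * Real.sqrt s := by
  have hmem : x k ∈ Set.Ioo (-(((k - 1 : ℕ) : ℝ) + 1)) (-((k - 1 : ℕ) : ℝ)) := by
    have h := (hxk k hk1).1
    rw [Nat.cast_sub hk1]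
    push_cast
    exact ⟨by linarith [h.1], by linarith [h.2]⟩
  have hmem' : x (k + 1) ∈ Set.Ioo (-((k : ℝ) + 1)) (-(k : ℝ)) := by
    have h := (hxk (k + 1) (by omega)).1
    push_cast at h
    exact ⟨by linarith [h.1], by linarith [h.2]⟩
  have hneg : Real.Gamma (x k) < 0 := by
    rw [exp_re_logGamma_ofReal hmem, Nat.sub_add_cancel hk1, hkodd.neg_one_pow]
    linarith [Real.exp_pos (logGamma (x k)).re]
  have hpos : 0 < Real.Gamma (x (k + 1)) := by
    rw [exp_re_logGamma_ofReal hmem', hkodd.add_one.neg_one_pow, one_mul]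
    exact Real.exp_pos _
  obtain ⟨C₁, hC₁, h₁⟩ := eventually_norm_sub_le_of_logGamma_eq hmem (hxk k hk1).2 hkodd
    (Or.inl (Nat.sub_add_cancel hk1)) hgim hgL
  obtain ⟨C₂, hC₂, h₂⟩ := eventually_norm_sub_le_of_logGamma_eq hmem' (hxk (k + 1) (by omega)).2
    hkodd (Or.inr rfl) hgim hgL
  have hs₁ := eventually_le_mul_sqrt_of_tendsto_im (e := 1) (by simp) h₁
  have hs₂ := eventually_le_mul_sqrt_of_tendsto_im (e := -1) (by simp) h₂
  refine ⟨max C₁ C₂, lt_max_of_lt_left hC₁, ?_⟩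
  obtain ⟨r, hr, hsub⟩ := mem_nhdsGT_iff_exists_Ioo_subset.1 (hs₁.and hs₂)
  have hr : 0 < r := hr
  refine ⟨min r (min (-Real.Gamma (x k)) (Real.Gamma (x (k + 1)))),
    lt_min hr (lt_min (by linarith) hpos), fun s hs0 hs => ?_⟩
  obtain ⟨hsr, hs'⟩ := lt_min_iff.1 hs
  obtain ⟨hsl, hsu⟩ := lt_min_iff.1 hs'
  obtain ⟨hb₁, hb₂⟩ := hsub ⟨hs0, hsr⟩
  constructor
  · have ht := hd (Real.Gamma (x k) + s) ⟨⟨by linarith, by linarith⟩, by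
      simp only [Set.mem_singleton_iff]; linarith⟩
    refine (hb₁ _ (by rwa [one_mul])).trans ?_
    gcongr
    exact le_max_left _ _
  · have ht := hd (Real.Gamma (x (k + 1)) - s) ⟨⟨by linarith, by linarith⟩, by
      simp only [Set.mem_singleton_iff]; linarith⟩
    refine (hb₂ _ (by rwa [neg_one_mul, ← sub_eq_add_neg])).trans ?_
    gcongr
    exact le_max_right _ _
end
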